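/- Let Ω ⊂ ℝ² be a connected open set containing 0 and let A = (aⁱʲ) be a smooth symmetric positive definite matrix function on Ω. Let f₁₁, f₁₂, f₂₁, f₂₂ be smooth A-harmonic functions on Ω (i.e. ∂_i(aⁱʲ∂_j f_{kl}) = 0 for all k, l) such that f₁₁f₂₂ − f₁₂f₂₁ vanishes to infinite order at 0 and f_{kl}(0) = 0 for all k, l = 1, 2. Then f₁₁f₂₂ = f₁₂f₂₁ identically on Ω. -/

import Mathlib

/-- Partial derivative on `ℝ × ℝ` in the `i`-th coordinate direction. -/
noncomputable def pd (i : Fin 2) (f : ℝ × ℝ → ℝ) (p : ℝ × ℝ) : ℝ :=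
  fderiv ℝ f p (if i = 0 then ((1:ℝ), (0:ℝ)) else (0, 1))

section

open Set Filter Topology MeasureTheory
open scoped ContDiff

theorem pd_contDiff {f : ℝ × ℝ → ℝ} (hf : ContDiff ℝ ∞ f) (i : Fin 2) : ContDiff ℝ ∞ (pd i f) := by
  unfold pd
  exact (hf.fderiv_right (m := ∞) (by simp)).clm_apply contDiff_const

theorem pd_add {f g : ℝ × ℝ → ℝ} (hf : ContDiff ℝ ∞ f) (hg : ContDiff ℝ ∞ g) (i : Fin 2)
    (p : ℝ × ℝ) : pd i (fun x => f x + g x) p = pd i f p + pd i g p := by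
  unfold pd
  rw [fderiv_fun_add (hf.differentiable (by simp) p) (hg.differentiable (by simp) p)]; rfl

theorem pd_sub {f g : ℝ × ℝ → ℝ} (hf : ContDiff ℝ ∞ f) (hg : ContDiff ℝ ∞ g) (i : Fin 2)
    (p : ℝ × ℝ) : pd i (fun x => f x - g x) p = pd i f p - pd i g p := by
  unfold pd
  rw [fderiv_fun_sub (hf.differentiable (by simp) p) (hg.differentiable (by simp) p)]; rfl

theorem pd_mul {f g : ℝ × ℝ → ℝ} (hf : ContDiff ℝ ∞ f) (hg : ContDiff ℝ ∞ g) (i : Fin 2)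
    (p : ℝ × ℝ) : pd i (fun x => f x * g x) p = pd i f p * g p + f p * pd i g p := by
  unfold pd
  rw [fderiv_fun_mul (hf.differentiable (by simp) p) (hg.differentiable (by simp) p)]
  simp; ring

theorem pd_const (c : ℝ) (i : Fin 2) (p : ℝ × ℝ) : pd i (fun _ => c) p = 0 := by
  simp [pd]

theorem pd_comp {f : ℝ × ℝ → ℝ} {h : ℝ → ℝ} {h' : ℝ} (hf : ContDiff ℝ ∞ f) (p : ℝ × ℝ)
    (hh : HasDerivAt h h' (f p)) (i : Fin 2) : pd i (fun x => h (f x)) p = h' * pd i f p := by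
  unfold pd
  have := hh.comp_hasFDerivAt p (hf.differentiable (by simp) p).hasFDerivAt
  have h2 : fderiv ℝ (fun x => h (f x)) p = h' • fderiv ℝ f p := this.fderiv
  rw [h2]; simp

theorem pd_comm {f : ℝ × ℝ → ℝ} (hf : ContDiff ℝ ∞ f) (p : ℝ × ℝ) :
    pd 0 (pd 1 f) p = pd 1 (pd 0 f) p := by
  have hs : IsSymmSndFDerivAt ℝ f p := (hf.contDiffAt).isSymmSndFDerivAt (by
    simpa using WithTop.coe_le_coe.2 (le_top : (2 : ℕ∞) ≤ ⊤))
  have hd : DifferentiableAt ℝ (fderiv ℝ f) p :=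
    (hf.fderiv_right (m := ∞) (by simp)).differentiable (by simp) p
  have key : ∀ v w : ℝ × ℝ, fderiv ℝ (fun x => fderiv ℝ f x v) p w =
      fderiv ℝ (fderiv ℝ f) p w v := by
    intro v w
    rw [fderiv_clm_apply hd (differentiableAt_const v)]; simp
  unfold pd
  rw [key, key]
  exact hs _ _

theorem Filter.EventuallyEq.pd {f g : ℝ × ℝ → ℝ} {p : ℝ × ℝ} (h : f =ᶠ[𝓝 p] g) (i : Fin 2) :
    pd i f =ᶠ[𝓝 p] pd i g := by
  filter_upwards [h.fderiv (𝕜 := ℝ)] with x hx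
  simp [_root_.pd, hx]

theorem integral_pd_eq_zero {f : ℝ × ℝ → ℝ} (hf : ContDiff ℝ ∞ f) (hc : HasCompactSupport f)
    (i : Fin 2) : ∫ p, pd i f p = 0 := by
  unfold pd
  set v : ℝ × ℝ := (if i = 0 then ((1:ℝ), (0:ℝ)) else (0, 1))
  have h := integral_mul_fderiv_eq_neg_fderiv_mul_of_integrable
    (μ := (volume : Measure (ℝ × ℝ))) (f := fun _ : ℝ × ℝ => (1:ℝ)) (g := f) (v := v)
    (by simp) (by
      simp
      exact ((hf.fderiv_right (m := ∞) (by simp)).clm_apply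
        contDiff_const).continuous.integrable_of_hasCompactSupport (hc.fderiv_apply (𝕜 := ℝ) v))
    (by simpa using hf.continuous.integrable_of_hasCompactSupport hc) (by fun_prop)
    (fun x _ => hf.differentiable (by simp) x)
  simpa using h

theorem exists_contDiff_eventuallyEq {f : ℝ × ℝ → ℝ} {U : Set (ℝ × ℝ)} (hU : IsOpen U)
    (hf : ContDiffOn ℝ ∞ f U) {p : ℝ × ℝ} (hp : p ∈ U) :
    ∃ g, ContDiff ℝ ∞ g ∧ g =ᶠ[𝓝 p] f := by
  obtain ⟨ε, hε, hball⟩ := Metric.isOpen_iff.1 hU p hp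
  let χ : ContDiffBump p := ⟨ε / 3, ε / 2, by positivity, by linarith⟩
  refine ⟨fun x => χ x * f x, ?_, ?_⟩
  · rw [contDiff_iff_contDiffAt]
    intro x
    by_cases hx : x ∈ U
    · exact χ.contDiff.contDiffAt.mul (hf.contDiffAt (hU.mem_nhds hx))
    · have hx' : x ∉ tsupport χ := by
        rw [χ.tsupport_eq]
        intro h
        exact hx (hball (Metric.closedBall_subset_ball (by change ε / 2 < ε; linarith) h))
      have h0 : (fun x => χ x * f x) =ᶠ[𝓝 x] fun _ => 0 := by
        filter_upwards [notMem_tsupport_iff_eventuallyEq.1 hx'] with y hy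
        simp [hy]
      exact contDiffAt_const.congr_of_eventuallyEq h0
  · filter_upwards [χ.eventuallyEq_one] with y hy
    simp [hy]

def Flat (p : ℝ × ℝ) : ℕ → (ℝ × ℝ → ℝ) → Prop
  | 0, _ => True
  | n + 1, f => f p = 0 ∧ ∀ i, Flat p n (pd i f)

namespace Flat

variable {p : ℝ × ℝ}

theorem congr {n : ℕ} {f g : ℝ × ℝ → ℝ} (h : f =ᶠ[𝓝 p] g) (hf : Flat p n f) : Flat p n g := by
  induction n generalizing f g with
  | zero => trivial
  | succ n ih => exact ⟨h.eq_of_nhds ▸ hf.1, fun i => ih (h.pd i) (hf.2 i)⟩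

theorem pred {n : ℕ} {f : ℝ × ℝ → ℝ} (hf : Flat p (n + 1) f) : Flat p n f := by
  induction n generalizing f with
  | zero => trivial
  | succ n ih => exact ⟨hf.1, fun i => ih (hf.2 i)⟩

theorem mono {n m : ℕ} (hnm : n ≤ m) {f : ℝ × ℝ → ℝ} (hf : Flat p m f) : Flat p n f := by
  induction m, hnm using Nat.le_induction with
  | base => exact hf
  | succ m _ ih => exact ih hf.pred

theorem pd_sub_one {n : ℕ} {f : ℝ × ℝ → ℝ} (hf : Flat p n f) (i : Fin 2) :
    Flat p (n - 1) (pd i f) := by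
  cases n with
  | zero => trivial
  | succ n => exact hf.2 i

theorem add {n : ℕ} {f g : ℝ × ℝ → ℝ} (hf : ContDiff ℝ ∞ f) (hg : ContDiff ℝ ∞ g)
    (h1 : Flat p n f) (h2 : Flat p n g) : Flat p n (fun x => f x + g x) := by
  induction n generalizing f g with
  | zero => trivial
  | succ n ih =>
    refine ⟨by simp [h1.1, h2.1], fun i => ?_⟩
    rw [show pd i (fun x => f x + g x) = fun x => pd i f x + pd i g x from
      funext (pd_add hf hg i)]
    exact ih (pd_contDiff hf i) (pd_contDiff hg i) (h1.2 i) (h2.2 i)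

theorem mul {n m k : ℕ} {f g : ℝ × ℝ → ℝ} (hf : ContDiff ℝ ∞ f) (hg : ContDiff ℝ ∞ g)
    (h1 : Flat p n f) (h2 : Flat p m g) (hk : k ≤ n + m) : Flat p k (fun x => f x * g x) := by
  induction k generalizing f g n m with
  | zero => trivial
  | succ k ih =>
    refine ⟨?_, fun i => ?_⟩
    · rcases n with _ | n
      · rcases m with _ | m
        · omega
        · simp [h2.1]
      · simp [h1.1]
    rw [show pd i (fun x => f x * g x) = fun x => pd i f x * g x + f x * pd i g x from
      funext (pd_mul hf hg i)]
    exact add ((pd_contDiff hf i).mul hg) (hf.mul (pd_contDiff hg i))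
      (ih (pd_contDiff hf i) hg (h1.pd_sub_one i) h2 (by omega))
      (ih hf (pd_contDiff hg i) h1 (h2.pd_sub_one i) (by omega))

theorem mul_left {n : ℕ} {f g : ℝ × ℝ → ℝ} (hf : ContDiff ℝ ∞ f) (hg : ContDiff ℝ ∞ g)
    (h : Flat p n g) : Flat p n (fun x => f x * g x) :=
  mul (n := 0) hf hg trivial h (by omega)

theorem sub {n : ℕ} {f g : ℝ × ℝ → ℝ} (hf : ContDiff ℝ ∞ f) (hg : ContDiff ℝ ∞ g)
    (h1 : Flat p n f) (h2 : Flat p n g) : Flat p n (fun x => f x - g x) := by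
  have := add hf (contDiff_const.mul hg) h1
    (mul_left (contDiff_const (c := (-1 : ℝ))) hg h2)
  simpa [sub_eq_add_neg] using this

theorem iterate_pd {n k : ℕ} {f : ℝ × ℝ → ℝ} (h : Flat p n f) (hk : k < n) (i : Fin 2) :
    (pd i)^[k] f p = 0 := by
  induction k generalizing f n with
  | zero =>
    obtain ⟨n, rfl⟩ := Nat.exists_eq_add_of_lt hk
    simpa using (h.mono (n := 1) (by omega)).1
  | succ k ih =>
    rw [Function.iterate_succ_apply]
    exact ih (h.pd_sub_one i) (by omega)

theorem exists_bound {n : ℕ} {f : ℝ × ℝ → ℝ} (hf : ContDiff ℝ ∞ f) (h : Flat p n f) (R : ℝ) :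
    ∃ C, 0 ≤ C ∧ ∀ x ∈ Metric.closedBall p R, |f x| ≤ C * ‖x - p‖ ^ n := by
  induction n generalizing f with
  | zero =>
    obtain ⟨C, hC⟩ :=
      (isCompact_closedBall p R).exists_bound_of_continuousOn hf.continuous.continuousOn
    exact ⟨max C 0, le_max_right _ _, fun x hx => by simpa using Or.inl (hC x hx)⟩
  | succ n ih =>
    obtain ⟨C, hC0, hC⟩ := ih (pd_contDiff hf 0) (h.2 0)
    obtain ⟨D, hD0, hD⟩ := ih (pd_contDiff hf 1) (h.2 1)
    refine ⟨C + D, by positivity, fun x hx => ?_⟩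
    have hb : ∀ y ∈ Metric.closedBall p ‖x - p‖, ‖fderiv ℝ f y‖ ≤ (C + D) * ‖x - p‖ ^ n := by
      intro y hy
      have hyn : ‖y - p‖ ≤ ‖x - p‖ := by simpa [dist_eq_norm] using hy
      have hxR : ‖x - p‖ ≤ R := by simpa [dist_eq_norm] using hx
      have hyR : y ∈ Metric.closedBall p R := by
        simpa [dist_eq_norm] using hyn.trans hxR
      have hpow : ‖y - p‖ ^ n ≤ ‖x - p‖ ^ n := by gcongr
      refine ContinuousLinearMap.opNorm_le_bound _ (by positivity) fun v => ?_
      have hv : fderiv ℝ f y v = v.1 * pd 0 f y + v.2 * pd 1 f y := by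
        have : v = v.1 • ((1 : ℝ), (0 : ℝ)) + v.2 • ((0 : ℝ), (1 : ℝ)) := by ext <;> simp
        conv_lhs => rw [this]
        rw [map_add, map_smul, map_smul]
        simp [pd]
      have h1 : |v.1| ≤ ‖v‖ := norm_fst_le v
      have h2 : |v.2| ≤ ‖v‖ := norm_snd_le v
      rw [hv, Real.norm_eq_abs]
      calc |v.1 * pd 0 f y + v.2 * pd 1 f y| ≤ |v.1| * |pd 0 f y| + |v.2| * |pd 1 f y| := by
            rw [← abs_mul, ← abs_mul]; exact abs_add_le _ _
        _ ≤ ‖v‖ * (C * ‖x - p‖ ^ n) + ‖v‖ * (D * ‖x - p‖ ^ n) := by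
            gcongr
            · exact (hC y hyR).trans (by gcongr)
            · exact (hD y hyR).trans (by gcongr)
        _ = (C + D) * ‖x - p‖ ^ n * ‖v‖ := by ring
    have := (convex_closedBall p ‖x - p‖).norm_image_sub_le_of_norm_fderiv_le
      (fun y _ => hf.differentiable (by simp) y) hb (x := p) (y := x) (by simp)
        (by simp [dist_eq_norm])
    rw [h.1, sub_zero, Real.norm_eq_abs] at this
    rw [pow_succ, ← mul_assoc]
    exact this

theorem of_iteratedFDeriv {f : ℝ × ℝ → ℝ} (hf : ContDiff ℝ ∞ f)
    (h : ∀ n, iteratedFDeriv ℝ n f p = 0) (n : ℕ) : Flat p n f := by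
  induction n generalizing f with
  | zero => trivial
  | succ n ih =>
    refine ⟨?_, fun i => ih (pd_contDiff hf i) fun m => ?_⟩
    · have := congrArg norm (h 0)
      simpa using this
    · have h1 : iteratedFDeriv ℝ m (fderiv ℝ f) p = 0 := by
        rw [← norm_eq_zero, norm_iteratedFDeriv_fderiv, h, norm_zero]
      have h2 := (ContinuousLinearMap.apply ℝ ℝ
        (if i = 0 then ((1:ℝ), (0:ℝ)) else (0, 1))).iteratedFDeriv_comp_left
          (x := p) (i := m) (n := m)
        ((hf.fderiv_right (m := m) (by exact_mod_cast le_top)).contDiffAt) le_rfl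
      rw [h1] at h2
      have h3 : pd i f = (ContinuousLinearMap.apply ℝ ℝ
        (if i = 0 then ((1:ℝ), (0:ℝ)) else (0, 1))) ∘ fderiv ℝ f := by ext; simp [pd]
      rw [h3, h2]; ext; simp

theorem of_mem_closure {S : Set (ℝ × ℝ)} {f : ℝ × ℝ → ℝ} (hf : ContDiff ℝ ∞ f)
    (hS : ∀ q ∈ S, f =ᶠ[𝓝 q] 0) (hp : p ∈ closure S) (n : ℕ) : Flat p n f := by
  induction n generalizing f with
  | zero => trivial
  | succ n ih =>
    refine ⟨?_, fun i => ih (pd_contDiff hf i) fun q hq => ?_⟩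
    · have : closure S ⊆ {x | f x = 0} :=
        closure_minimal (fun q hq => (hS q hq).eq_of_nhds)
          (isClosed_eq hf.continuous continuous_const)
      exact this hp
    · have := (hS q hq).pd i
      refine this.trans (Eventually.of_forall fun x => ?_)
      exact pd_const 0 i x

end Flat

noncomputable def weightDiv (q r ψ : ℝ × ℝ → ℝ) (x : ℝ × ℝ) : ℝ :=
  pd 0 (fun y => (1 + q y ^ 2) / r y * pd 0 ψ y + q y * pd 1 ψ y) x +
    pd 1 (fun y => q y * pd 0 ψ y + r y * pd 1 ψ y) x

theorem weightDiv_contDiff {q r ψ : ℝ × ℝ → ℝ} (hq : ContDiff ℝ ∞ q) (hr : ContDiff ℝ ∞ r)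
    (hψ : ContDiff ℝ ∞ ψ) (hr0 : ∀ x, 0 < r x) : ContDiff ℝ ∞ (weightDiv q r ψ) := by
  have hψ0 := pd_contDiff hψ 0
  have hψ1 := pd_contDiff hψ 1
  have hp : ContDiff ℝ ∞ fun y => (1 + q y ^ 2) / r y :=
    ContDiff.div (by fun_prop) hr fun y => (hr0 y).ne'
  exact (pd_contDiff (by fun_prop) 0).add (pd_contDiff (by fun_prop) 1)

theorem carleman_conjugated {q r ψ f g : ℝ × ℝ → ℝ} (hq : ContDiff ℝ ∞ q) (hr : ContDiff ℝ ∞ r)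
    (hψ : ContDiff ℝ ∞ ψ) (hf : ContDiff ℝ ∞ f) (hg : ContDiff ℝ ∞ g) (hr0 : ∀ x, 0 < r x)
    (hfc : HasCompactSupport f) (hgc : HasCompactSupport g) :
    0 ≤ ∫ x, (((q x * (pd 0 f x - f x * pd 0 ψ x) + r x * (pd 1 f x - f x * pd 1 ψ x) +
        (pd 0 g x - g x * pd 0 ψ x)) ^ 2 +
      (q x * (pd 0 g x - g x * pd 0 ψ x) + r x * (pd 1 g x - g x * pd 1 ψ x) -
        (pd 0 f x - f x * pd 0 ψ x)) ^ 2) / r x -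
      2 * (f x ^ 2 + g x ^ 2) * weightDiv q r ψ x) := by
  have hψ0 := pd_contDiff hψ 0
  have hψ1 := pd_contDiff hψ 1
  have hf0 := pd_contDiff hf 0
  have hf1 := pd_contDiff hf 1
  have hg0 := pd_contDiff hg 0
  have hg1 := pd_contDiff hg 1
  have hp : ContDiff ℝ ∞ fun y => (1 + q y ^ 2) / r y :=
    ContDiff.div (by fun_prop) hr fun y => (hr0 y).ne'
  set V : ℝ × ℝ → ℝ := fun y => (1 + q y ^ 2) / r y * pd 0 ψ y + q y * pd 1 ψ y with hV
  set W : ℝ × ℝ → ℝ := fun y => q y * pd 0 ψ y + r y * pd 1 ψ y with hW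
  have hVs : ContDiff ℝ ∞ V := by fun_prop
  have hWs : ContDiff ℝ ∞ W := by fun_prop
  set P : ℝ × ℝ → ℝ := fun y => g y * (4 * pd 1 f y - 2 * (g y * V y)) - f y * (2 * (f y * V y))
  set Q : ℝ × ℝ → ℝ := fun y => g y * (-4 * pd 0 f y - 2 * (g y * W y)) - f y * (2 * (f y * W y))
  have hP : ContDiff ℝ ∞ P := by fun_prop
  have hQ : ContDiff ℝ ∞ Q := by fun_prop
  have hPc : HasCompactSupport P := (hgc.mul_right).sub hfc.mul_right
  have hQc : HasCompactSupport Q := (hgc.mul_right).sub hfc.mul_right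
  set E : ℝ × ℝ → ℝ := fun x =>
    ((q x * (pd 0 f x + f x * pd 0 ψ x) + r x * (pd 1 f x + f x * pd 1 ψ x) -
        (pd 0 g x + g x * pd 0 ψ x)) ^ 2 +
      (q x * (pd 0 g x + g x * pd 0 ψ x) + r x * (pd 1 g x + g x * pd 1 ψ x) +
        (pd 0 f x + f x * pd 0 ψ x)) ^ 2) / r x with hE
  have hE0 : ∀ x, 0 ≤ E x := fun x => by have := hr0 x; positivity
  have key : ∀ x, (((q x * (pd 0 f x - f x * pd 0 ψ x) + r x * (pd 1 f x - f x * pd 1 ψ x) +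
        (pd 0 g x - g x * pd 0 ψ x)) ^ 2 +
      (q x * (pd 0 g x - g x * pd 0 ψ x) + r x * (pd 1 g x - g x * pd 1 ψ x) -
        (pd 0 f x - f x * pd 0 ψ x)) ^ 2) / r x -
      2 * (f x ^ 2 + g x ^ 2) * weightDiv q r ψ x) = E x + (pd 0 P x + pd 1 Q x) := by
    intro x
    have h1 : pd 0 P x = pd 0 g x * (4 * pd 1 f x - 2 * (g x * V x)) +
        g x * (4 * pd 0 (pd 1 f) x - 2 * (pd 0 g x * V x + g x * pd 0 V x)) -
        (pd 0 f x * (2 * (f x * V x)) + f x * (2 * (pd 0 f x * V x + f x * pd 0 V x))) := by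
      simp only [P]
      rw [pd_sub (by fun_prop) (by fun_prop), pd_mul (by fun_prop) (by fun_prop),
        pd_mul (by fun_prop) (by fun_prop), pd_sub (by fun_prop) (by fun_prop),
        pd_mul (by fun_prop) (by fun_prop), pd_mul (by fun_prop) (by fun_prop),
        pd_mul (by fun_prop) (by fun_prop), pd_mul (by fun_prop) (by fun_prop),
        pd_mul (by fun_prop) (by fun_prop)]
      simp only [pd_const]
      ring
    have h2 : pd 1 Q x = pd 1 g x * (-4 * pd 0 f x - 2 * (g x * W x)) +
        g x * (-4 * pd 1 (pd 0 f) x - 2 * (pd 1 g x * W x + g x * pd 1 W x)) -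
        (pd 1 f x * (2 * (f x * W x)) + f x * (2 * (pd 1 f x * W x + f x * pd 1 W x))) := by
      simp only [Q]
      rw [pd_sub (by fun_prop) (by fun_prop), pd_mul (by fun_prop) (by fun_prop),
        pd_mul (by fun_prop) (by fun_prop), pd_sub (by fun_prop) (by fun_prop),
        pd_mul (by fun_prop) (by fun_prop), pd_mul (by fun_prop) (by fun_prop),
        pd_mul (by fun_prop) (by fun_prop), pd_mul (by fun_prop) (by fun_prop),
        pd_mul (by fun_prop) (by fun_prop)]
      simp only [pd_const]
      ring
    rw [h1, h2, pd_comm hf x]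
    change _ - 2 * (f x ^ 2 + g x ^ 2) * (pd 0 V x + pd 1 W x) = _
    simp only [hE]
    rw [show V x = (1 + q x ^ 2) / r x * pd 0 ψ x + q x * pd 1 ψ x from rfl,
      show W x = q x * pd 0 ψ x + r x * pd 1 ψ x from rfl]
    have := (hr0 x).ne'
    field_simp
    ring
  have hPi : Integrable (pd 0 P) := (pd_contDiff hP 0).continuous.integrable_of_hasCompactSupport
    (hPc.fderiv_apply (𝕜 := ℝ) _)
  have hQi : Integrable (pd 1 Q) := (pd_contDiff hQ 1).continuous.integrable_of_hasCompactSupport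
    (hQc.fderiv_apply (𝕜 := ℝ) _)
  have hEi : Integrable E := by
    refine Continuous.integrable_of_hasCompactSupport ?_ ?_
    · exact Continuous.div (by fun_prop) hr.continuous fun x => (hr0 x).ne'
    · refine HasCompactSupport.intro' (hfc.isCompact.union hgc.isCompact)
        ((isClosed_tsupport f).union (isClosed_tsupport g)) fun x hx => ?_
      rw [mem_union, not_or] at hx
      have h1 := notMem_tsupport_iff_eventuallyEq.1 hx.1
      have h2 := notMem_tsupport_iff_eventuallyEq.1 hx.2
      have hz : ∀ i, pd i (0 : ℝ × ℝ → ℝ) x = 0 := fun i => pd_const 0 i x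
      simp only [hE]
      rw [(h1.pd 0).eq_of_nhds, (h1.pd 1).eq_of_nhds, (h2.pd 0).eq_of_nhds,
        (h2.pd 1).eq_of_nhds, hz, hz, h1.eq_of_nhds, h2.eq_of_nhds]
      simp
  rw [integral_congr_ae (Eventually.of_forall key),
    integral_add hEi (g := fun x => pd 0 P x + pd 1 Q x) (hPi.add hQi),
    integral_add hPi hQi, integral_pd_eq_zero hP hPc, integral_pd_eq_zero hQ hQc]
  simpa using integral_nonneg hE0

theorem carleman {q r ψ f g : ℝ × ℝ → ℝ} (hq : ContDiff ℝ ∞ q) (hr : ContDiff ℝ ∞ r)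
    (hψ : ContDiff ℝ ∞ ψ) (hf : ContDiff ℝ ∞ f) (hg : ContDiff ℝ ∞ g) (hr0 : ∀ x, 0 < r x)
    (hfc : HasCompactSupport f) (hgc : HasCompactSupport g) :
    0 ≤ ∫ x, Real.exp (2 * ψ x) * (((q x * pd 0 f x + r x * pd 1 f x + pd 0 g x) ^ 2 +
      (q x * pd 0 g x + r x * pd 1 g x - pd 0 f x) ^ 2) / r x -
      2 * (f x ^ 2 + g x ^ 2) * weightDiv q r ψ x) := by
  have he : ContDiff ℝ ∞ fun x => Real.exp (ψ x) := hψ.exp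
  have hd : ∀ i x, pd i (fun x => Real.exp (ψ x)) x = Real.exp (ψ x) * pd i ψ x := fun i x =>
    pd_comp hψ x (Real.hasDerivAt_exp _) i
  have h := carleman_conjugated hq hr hψ (he.mul hf) (he.mul hg) hr0 hfc.mul_left hgc.mul_left
  refine h.trans_eq (integral_congr_ae (Eventually.of_forall fun x => ?_))
  simp only
  rw [pd_mul he hf, pd_mul he hf, pd_mul he hg, pd_mul he hg, hd, hd,
    show Real.exp (2 * ψ x) = Real.exp (ψ x) ^ 2 by rw [← Real.exp_nat_mul]; norm_num]
  ring

theorem weightDiv_comp {q r s : ℝ × ℝ → ℝ} (hq : ContDiff ℝ ∞ q) (hr : ContDiff ℝ ∞ r)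
    (hs : ContDiff ℝ ∞ s) (hr0 : ∀ x, 0 < r x) {h h₁ h₂ : ℝ → ℝ}
    (hh : ∀ x, HasDerivAt h (h₁ (s x)) (s x)) (hh₁ : ∀ x, HasDerivAt h₁ (h₂ (s x)) (s x))
    (hsm : ContDiff ℝ ∞ fun x => h₁ (s x)) (x : ℝ × ℝ) :
    weightDiv q r (fun y => h (s y)) x = h₁ (s x) * weightDiv q r s x +
      h₂ (s x) * ((1 + q x ^ 2) / r x * pd 0 s x ^ 2 + 2 * q x * (pd 0 s x * pd 1 s x) +
        r x * pd 1 s x ^ 2) := by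
  have hs0 := pd_contDiff hs 0
  have hs1 := pd_contDiff hs 1
  have hp : ContDiff ℝ ∞ fun y => (1 + q y ^ 2) / r y :=
    ContDiff.div (by fun_prop) hr fun y => (hr0 y).ne'
  have e : ∀ i, pd i (fun y => h (s y)) = fun y => h₁ (s y) * pd i s y :=
    fun i => funext fun y => pd_comp hs y (hh y) i
  have e0 : (fun y => (1 + q y ^ 2) / r y * (h₁ (s y) * pd 0 s y) + q y * (h₁ (s y) * pd 1 s y)) =
      fun y => h₁ (s y) * ((1 + q y ^ 2) / r y * pd 0 s y + q y * pd 1 s y) := by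
    ext y; ring
  have e1 : (fun y => q y * (h₁ (s y) * pd 0 s y) + r y * (h₁ (s y) * pd 1 s y)) =
      fun y => h₁ (s y) * (q y * pd 0 s y + r y * pd 1 s y) := by
    ext y; ring
  unfold weightDiv
  rw [e, e, e0, e1, pd_mul hsm (by fun_prop), pd_mul hsm (by fun_prop), pd_comp hs x (hh₁ x),
    pd_comp hs x (hh₁ x)]
  ring

theorem exists_radial_weight {q r : ℝ × ℝ → ℝ} (hq : ContDiff ℝ ∞ q) (hr : ContDiff ℝ ∞ r)
    (hr0 : ∀ x, 0 < r x) (p : ℝ × ℝ) :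
    ∃ (s : ℝ × ℝ → ℝ) (m C : ℝ), ContDiff ℝ ∞ s ∧ s p = 0 ∧ 0 < m ∧ 0 ≤ C ∧
      (∀ x, m * ‖x - p‖ ^ 2 ≤ s x) ∧
      ∀ x ∈ Metric.closedBall p 1, |weightDiv q r s x - 4| ≤ C * √(s x) ∧
        |(1 + q x ^ 2) / r x * pd 0 s x ^ 2 + 2 * q x * (pd 0 s x * pd 1 s x) +
          r x * pd 1 s x ^ 2 - 4 * s x| ≤ C * √(s x) ^ 3 := by
  have hp : ContDiff ℝ ∞ fun y => (1 + q y ^ 2) / r y :=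
    ContDiff.div (by fun_prop) hr fun y => (hr0 y).ne'
  set q₀ := q p
  set r₀ := r p
  set P := (1 + q₀ ^ 2) / r₀ with hP
  have hr₀ : 0 < r₀ := hr0 p
  have hP0 : 0 < P := by positivity
  have hPr : P * r₀ = 1 + q₀ ^ 2 := by rw [hP]; field_simp
  obtain ⟨X, hXd⟩ : ∃ X : ℝ × ℝ → ℝ, X = fun x => x.1 - p.1 := ⟨_, rfl⟩
  obtain ⟨Y, hYd⟩ : ∃ Y : ℝ × ℝ → ℝ, Y = fun x => x.2 - p.2 := ⟨_, rfl⟩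
  have hX : ContDiff ℝ ∞ X := by rw [hXd]; fun_prop
  have hY : ContDiff ℝ ∞ Y := by rw [hYd]; fun_prop
  have dX : ∀ i x, pd i X x = if i = 0 then 1 else 0 := fun i x => by
    simp only [pd, hXd, fderiv_sub_const, fderiv_fst]; split_ifs <;> simp
  have dY : ∀ i x, pd i Y x = if i = 0 then 0 else 1 := fun i x => by
    simp only [pd, hYd, fderiv_sub_const, fderiv_snd]; split_ifs <;> simp
  obtain ⟨s, hsdef⟩ : ∃ s : ℝ × ℝ → ℝ,
      s = fun x => X x * (r₀ * X x - 2 * (q₀ * Y x)) + Y x * (P * Y x) := ⟨_, rfl⟩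
  have hs : ContDiff ℝ ∞ s := by rw [hsdef]; fun_prop
  have dlin : ∀ a b i x, pd i (fun x => a * X x + b * Y x) x = if i = 0 then a else b := by
    intro a b i x
    rw [pd_add (by fun_prop) (by fun_prop), pd_mul (by fun_prop) (by fun_prop),
      pd_mul (by fun_prop) (by fun_prop), dX, dY, pd_const, pd_const]
    split_ifs <;> ring
  have ds : ∀ i x, pd i s x = if i = 0 then 2 * r₀ * X x + (-2 * q₀) * Y x
      else (-2 * q₀) * X x + 2 * P * Y x := by
    intro i x
    simp only [hsdef]
    rw [pd_add (by fun_prop) (by fun_prop), pd_mul (by fun_prop) (by fun_prop),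
      pd_sub (by fun_prop) (by fun_prop), pd_mul (by fun_prop) (by fun_prop),
      pd_mul (by fun_prop) (by fun_prop), pd_mul (by fun_prop) (by fun_prop),
      pd_mul (by fun_prop) (by fun_prop), pd_mul (by fun_prop) (by fun_prop)]
    simp only [dX, dY, pd_const]
    split_ifs <;> ring
  have ds0 : pd 0 s = fun x => 2 * r₀ * X x + (-2 * q₀) * Y x := funext fun x => by simp [ds]
  have ds1 : pd 1 s = fun x => (-2 * q₀) * X x + 2 * P * Y x := funext fun x => by simp [ds]
  have hs0 := pd_contDiff hs 0
  have hs1 := pd_contDiff hs 1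
  have hXp : X p = 0 := by simp [hXd]
  have hYp : Y p = 0 := by simp [hYd]
  have hsp : s p = 0 := by simp [hsdef, hXp, hYp]
  have F1 : ∀ {f : ℝ × ℝ → ℝ}, f p = 0 → Flat p 1 f := fun h => ⟨h, fun _ => trivial⟩
  have fs0 : Flat p 1 (pd 0 s) := F1 (by simp [ds0, hXp, hYp])
  have fs1 : Flat p 1 (pd 1 s) := F1 (by simp [ds1, hXp, hYp])
  have hT1 : Flat p 1 (fun x => weightDiv q r s x - 4) := F1 (by
    have h4 : weightDiv q r s p = 4 := by
      unfold weightDiv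
      rw [pd_add (by fun_prop) (by fun_prop), pd_mul (by fun_prop) (by fun_prop),
        pd_mul (by fun_prop) (by fun_prop), pd_add (by fun_prop) (by fun_prop),
        pd_mul (by fun_prop) (by fun_prop), pd_mul (by fun_prop) (by fun_prop), fs0.1, fs1.1,
        show pd 0 (pd 0 s) p = 2 * r₀ by rw [ds0, dlin]; simp,
        show pd 0 (pd 1 s) p = -2 * q₀ by rw [ds1, dlin]; simp,
        show pd 1 (pd 0 s) p = -2 * q₀ by rw [ds0, dlin]; simp,
        show pd 1 (pd 1 s) p = 2 * P by rw [ds1, dlin]; simp]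
      change _ + P * _ + (_ + q₀ * _) + (_ + q₀ * _ + (_ + r₀ * _)) = _
      linear_combination 4 * hPr
    rw [h4, sub_self])
  have hT2 : Flat p 3 (fun x => ((1 + q x ^ 2) / r x - P) * (pd 0 s x * pd 0 s x) +
      ((2 * q x - 2 * q₀) * (pd 0 s x * pd 1 s x) + (r x - r₀) * (pd 1 s x * pd 1 s x))) := by
    refine Flat.add (by fun_prop) (by fun_prop) ?_ (Flat.add (by fun_prop) (by fun_prop) ?_ ?_)
    · exact Flat.mul (n := 1) (m := 2) (by fun_prop) (by fun_prop) (F1 (sub_self _))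
        (Flat.mul hs0 hs0 fs0 fs0 le_rfl) le_rfl
    · exact Flat.mul (n := 1) (m := 2) (by fun_prop) (by fun_prop) (F1 (sub_self _))
        (Flat.mul hs0 hs1 fs0 fs1 le_rfl) le_rfl
    · exact Flat.mul (n := 1) (m := 2) (by fun_prop) (by fun_prop) (F1 (sub_self _))
        (Flat.mul hs1 hs1 fs1 fs1 le_rfl) le_rfl
  obtain ⟨C, hC0, hC⟩ := hT1.exists_bound
    ((weightDiv_contDiff hq hr hs hr0).sub contDiff_const) 1
  obtain ⟨D, hD0, hD⟩ := hT2.exists_bound (by fun_prop) 1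
  set m := min (1 / r₀) (1 / P) with hm
  have hm0 : 0 < m := by positivity
  have hlow : ∀ x, m * ‖x - p‖ ^ 2 ≤ s x := by
    intro x
    have h1 : 1 / P * X x ^ 2 ≤ s x := by
      have : s x = 1 / P * X x ^ 2 + (P * Y x - q₀ * X x) ^ 2 / P := by
        simp only [hsdef]; field_simp
        linear_combination X x ^ 2 * hPr
      rw [this]; have : 0 ≤ (P * Y x - q₀ * X x) ^ 2 / P := by positivity
      linarith
    have h2 : 1 / r₀ * Y x ^ 2 ≤ s x := by
      have : s x = 1 / r₀ * Y x ^ 2 + (r₀ * X x - q₀ * Y x) ^ 2 / r₀ := by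
        simp only [hsdef]; field_simp
        linear_combination Y x ^ 2 * hPr
      rw [this]; have : 0 ≤ (r₀ * X x - q₀ * Y x) ^ 2 / r₀ := by positivity
      linarith
    have hn : ‖x - p‖ = max |X x| |Y x| := by simp [Prod.norm_def, hXd, hYd]
    rw [hn]
    rcases max_cases |X x| |Y x| with ⟨h, _⟩ | ⟨h, _⟩
    · rw [h, sq_abs]; exact le_trans (by gcongr; exact min_le_right _ _) h1
    · rw [h, sq_abs]; exact le_trans (by gcongr; exact min_le_left _ _) h2
  have hnorm : ∀ x, ‖x - p‖ ≤ √(s x) / √m := by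
    intro x
    rw [← Real.sqrt_div' _ hm0.le]
    refine Real.le_sqrt_of_sq_le ?_
    rw [le_div_iff₀ hm0, mul_comm]
    exact hlow x
  refine ⟨s, m, C / √m + D / √m ^ 3, hs, hsp, hm0, by positivity, hlow, fun x hx => ⟨?_, ?_⟩⟩
  · calc _ ≤ C * ‖x - p‖ ^ 1 := hC x hx
      _ ≤ C * (√(s x) / √m) := by rw [pow_one]; gcongr; exact hnorm x
      _ = C / √m * √(s x) := by ring
      _ ≤ _ := by gcongr; exact le_add_of_nonneg_right (by positivity)
  · have e : (1 + q x ^ 2) / r x * pd 0 s x ^ 2 + 2 * q x * (pd 0 s x * pd 1 s x) +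
        r x * pd 1 s x ^ 2 - 4 * s x = ((1 + q x ^ 2) / r x - P) * (pd 0 s x * pd 0 s x) +
      ((2 * q x - 2 * q₀) * (pd 0 s x * pd 1 s x) + (r x - r₀) * (pd 1 s x * pd 1 s x)) := by
      have : P * pd 0 s x ^ 2 + 2 * q₀ * (pd 0 s x * pd 1 s x) + r₀ * pd 1 s x ^ 2 = 4 * s x := by
        rw [ds0, ds1]; simp only [hsdef]
        linear_combination (4 * r₀ * X x ^ 2 - 8 * q₀ * X x * Y x + 4 * P * Y x ^ 2) * hPr
      linear_combination this
    rw [e]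
    calc _ ≤ D * ‖x - p‖ ^ 3 := hD x hx
      _ ≤ D * (√(s x) / √m) ^ 3 := by gcongr; exact hnorm x
      _ = D / √m ^ 3 * √(s x) ^ 3 := by ring
      _ ≤ _ := by gcongr; exact le_add_of_nonneg_left (by positivity)

theorem weight_lower_bound {C K σ δ s T₁ T₂ : ℝ} (hC : 0 ≤ C) (hK : K = 2 * C + 2) (hσ : 0 < σ)
    (hδ : 0 ≤ δ) (hs : s + δ = σ ^ 2) (h1 : |T₁ - 4| ≤ C * σ) (h2 : |T₂ - 4 * s| ≤ C * σ ^ 3)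
    (hsmall : 3 * K * C * σ ≤ 4) :
    1 / σ - 4 * δ / σ ^ 4 ≤
      (-1 / σ ^ 2 + K / (2 * σ)) * T₁ + (1 / σ ^ 4 - K / (4 * σ ^ 3)) * T₂ := by
  have hK0 : 0 ≤ K := by linarith
  have b1 : |(-1 / σ ^ 2 + K / (2 * σ)) * (T₁ - 4)| ≤ (1 / σ ^ 2 + K / (2 * σ)) * (C * σ) := by
    rw [abs_mul]
    refine mul_le_mul ?_ h1 (abs_nonneg _) (by positivity)
    refine (abs_add_le _ _).trans_eq ?_
    rw [neg_div, abs_neg, abs_of_nonneg (by positivity), abs_of_nonneg (by positivity)]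
  have b2 : |(1 / σ ^ 4 - K / (4 * σ ^ 3)) * (T₂ - 4 * s)| ≤
      (1 / σ ^ 4 + K / (4 * σ ^ 3)) * (C * σ ^ 3) := by
    rw [abs_mul]
    refine mul_le_mul ?_ h2 (abs_nonneg _) (by positivity)
    refine (abs_sub _ _).trans_eq ?_
    rw [abs_of_nonneg (by positivity), abs_of_nonneg (by positivity)]
  have e1 : (1 / σ ^ 2 + K / (2 * σ)) * (C * σ) + (1 / σ ^ 4 + K / (4 * σ ^ 3)) * (C * σ ^ 3) =
      2 * C / σ + 3 * K * C / 4 := by field_simp; ring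
  have e2 : 3 * K * C / 4 ≤ 1 / σ := by rw [le_div_iff₀ hσ]; linarith
  have e3 : (-1 / σ ^ 2 + K / (2 * σ)) * T₁ + (1 / σ ^ 4 - K / (4 * σ ^ 3)) * T₂ =
      (-1 / σ ^ 2 + K / (2 * σ)) * (T₁ - 4) + (1 / σ ^ 4 - K / (4 * σ ^ 3)) * (T₂ - 4 * s) +
      (K / σ - 4 * δ / σ ^ 4 + δ * K / σ ^ 3) := by
    rw [eq_sub_of_add_eq hs]; field_simp; ring
  have e4 : K / σ = 2 * C / σ + 2 * (1 / σ) := by rw [hK]; ring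
  have e5 : 0 ≤ δ * K / σ ^ 3 := by positivity
  rw [e3]
  linarith [(abs_le.1 b1).1, (abs_le.1 b2).1]

theorem neg_log_add_sqrt_antitone {K t₁ t₂ : ℝ} (h1 : 0 < t₁) (h12 : t₁ ≤ t₂)
    (h2 : K * √t₂ ≤ 1) : -Real.log t₂ + K * √t₂ ≤ -Real.log t₁ + K * √t₁ := by
  have hσ1 : 0 < √t₁ := Real.sqrt_pos.2 h1
  have hσ2 : 0 < √t₂ := Real.sqrt_pos.2 (h1.trans_le h12)
  have hle : √t₁ ≤ √t₂ := Real.sqrt_le_sqrt h12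
  have hl : ∀ t : ℝ, 0 < t → Real.log t = 2 * Real.log √t := fun t ht => by
    rw [Real.log_sqrt ht.le]; ring
  have h3 := Real.log_le_sub_one_of_pos (div_pos hσ1 hσ2)
  rw [Real.log_div hσ1.ne' hσ2.ne'] at h3
  rw [hl _ h1, hl _ (h1.trans_le h12)]
  have h4 : K * (√t₂ - √t₁) ≤ 1 - √t₁ / √t₂ := by
    rw [one_sub_div hσ2.ne', le_div_iff₀ hσ2]
    nlinarith
  have h5 : √t₁ / √t₂ ≤ 1 := (div_le_one hσ2).2 hle
  linarith

theorem exists_carleman_weight {q r s : ℝ × ℝ → ℝ} (hq : ContDiff ℝ ∞ q) (hr : ContDiff ℝ ∞ r)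
    (hs : ContDiff ℝ ∞ s) (hr0 : ∀ x, 0 < r x) (hs0 : ∀ x, 0 ≤ s x) {C K σ₀ ρ δ : ℝ} (hC : 0 ≤ C)
    (hK : K = 2 * C + 2) (hσ₀ : 0 < σ₀) (hσ1 : σ₀ ≤ 1) (hσ2 : 3 * K * C * σ₀ ≤ 4)
    (hσ3 : K * σ₀ ≤ 1) (hρ0 : 0 < ρ) (hρσ : ρ ≤ σ₀ ^ 2 / 2) (hδ : 0 < δ) (hδσ : δ ≤ σ₀ ^ 2 / 2)
    (n : ℕ) : ∃ ψ : ℝ × ℝ → ℝ, ContDiff ℝ ∞ ψ ∧ (∀ x, s x ≤ ρ → 0 ≤ ψ x) ∧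
      (∀ x, ρ ≤ s x → s x ≤ σ₀ ^ 2 / 2 → ψ x ≤ 0) ∧
      (∀ x, s x ≤ σ₀ ^ 2 / 2 →
        Real.exp (2 * ψ x) * (s x + δ) ^ (2 * n) ≤ Real.exp (2 * (n * K))) ∧
      ∀ x, s x ≤ σ₀ ^ 2 / 2 → |weightDiv q r s x - 4| ≤ C * √(s x) →
        |(1 + q x ^ 2) / r x * pd 0 s x ^ 2 + 2 * q x * (pd 0 s x * pd 1 s x) +
          r x * pd 1 s x ^ 2 - 4 * s x| ≤ C * √(s x) ^ 3 →
        n * (1 - 4 * δ / (s x + δ) ^ 2) ≤ weightDiv q r ψ x := by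
  have hK0 : 0 < K := by rw [hK]; positivity
  have hτ : ∀ x, 0 < s x + δ := fun x => by have := hs0 x; positivity
  have hsm : ContDiff ℝ ∞ fun x => s x + δ := by fun_prop
  have hsq : ContDiff ℝ ∞ fun x => √(s x + δ) := hsm.sqrt fun x => (hτ x).ne'
  have hlog : ContDiff ℝ ∞ fun x => Real.log (s x + δ) := hsm.log fun x => (hτ x).ne'
  obtain ⟨w, hw⟩ : ∃ w : ℝ → ℝ, w = fun t => -Real.log t + K * √t := ⟨_, rfl⟩
  have hwle : ∀ {t₁ t₂}, 0 < t₁ → t₁ ≤ t₂ → t₂ ≤ σ₀ ^ 2 → w t₂ ≤ w t₁ := by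
    intro t₁ t₂ h1 h2 h3
    rw [hw]
    refine neg_log_add_sqrt_antitone h1 h2 (le_trans ?_ hσ3)
    gcongr
    exact (Real.sqrt_le_left hσ₀.le).2 h3
  have hn : (0 : ℝ) ≤ n := n.cast_nonneg
  refine ⟨fun x => n * (w (s x + δ) - w (ρ + δ)), ?_, fun x hx => ?_, fun x hx hx' => ?_,
    fun x hx => ?_, fun x hx h1 h2 => ?_⟩
  · rw [hw]; simp only; fun_prop
  · exact mul_nonneg hn (sub_nonneg.2 (hwle (hτ x) (by linarith) (by linarith)))
  · exact mul_nonpos_of_nonneg_of_nonpos hn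
      (sub_nonpos.2 (hwle (by positivity) (by linarith) (by linarith)))
  · have h1 : 0 ≤ w (ρ + δ) := by
      have : Real.log (ρ + δ) ≤ 0 := Real.log_nonpos (by positivity) (by nlinarith)
      rw [hw]; simp only
      have : 0 ≤ K * √(ρ + δ) := by positivity
      linarith
    have h2 : K * √(s x + δ) ≤ K := by
      refine mul_le_of_le_one_right hK0.le (Real.sqrt_le_one.2 (by nlinarith))
    have h3 : (s x + δ) ^ (2 * n) = Real.exp (2 * n * Real.log (s x + δ)) := by
      rw [← Real.exp_log (hτ x), ← Real.exp_nat_mul, Real.log_exp]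
      push_cast; ring_nf
    rw [h3, ← Real.exp_add]
    refine Real.exp_le_exp.2 ?_
    have h4 : w (s x + δ) = -Real.log (s x + δ) + K * √(s x + δ) := by rw [hw]
    simp only
    rw [h4]
    nlinarith [mul_nonneg hn h1, mul_le_mul_of_nonneg_left h2 hn]
  · have hσp : 0 < √(s x + δ) := Real.sqrt_pos.2 (hτ x)
    have hσs : √(s x + δ) ^ 2 = s x + δ := Real.sq_sqrt (hτ x).le
    have hσle : √(s x + δ) ≤ σ₀ := (Real.sqrt_le_left hσ₀.le).2 (by linarith)
    have hmono : √(s x) ≤ √(s x + δ) := Real.sqrt_le_sqrt (by linarith)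
    have key := weight_lower_bound hC hK hσp hδ.le hσs.symm
      (h1.trans (by gcongr)) (h2.trans (by gcongr))
      (le_trans (by gcongr) hσ2)
    have e := weightDiv_comp (h := fun t => n * (w (t + δ) - w (ρ + δ)))
      (h₁ := fun t => n * (-1 / (t + δ) + K / (2 * √(t + δ))))
      (h₂ := fun t => n * (1 / (t + δ) ^ 2 - K / (4 * ((t + δ) * √(t + δ)))))
      hq hr hs hr0 ?_ ?_ ?_ x
    · rw [e]
      have hσ1' : 1 ≤ 1 / √(s x + δ) := (one_le_div hσp).2 (hσle.trans hσ1)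
      have e2 : √(s x + δ) ^ 4 = (s x + δ) ^ 2 := by
        rw [show 4 = 2 * 2 from rfl, pow_mul, hσs]
      have e3 : √(s x + δ) ^ 3 = (s x + δ) * √(s x + δ) := by rw [pow_succ, hσs]
      rw [e2, hσs, e3] at key
      nlinarith [mul_le_mul_of_nonneg_left (key.trans' (sub_le_sub_right hσ1' _)) hn]
    · intro y
      have hy := hτ y
      have d1 : HasDerivAt (fun t => t + δ) 1 (s y) := (hasDerivAt_id _).add_const _
      rw [hw]
      refine HasDerivAt.congr_deriv (f := fun t => n * (-Real.log (t + δ) + K * √(t + δ) -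
        (-Real.log (ρ + δ) + K * √(ρ + δ)))) ((((d1.log hy.ne').neg.add
        ((d1.sqrt hy.ne').const_mul K)).sub_const _).const_mul (n : ℝ)) ?_
      ring
    · intro y
      have hy := hτ y
      have hy' : 0 < √(s y + δ) := Real.sqrt_pos.2 hy
      have hy2 : √(s y + δ) ^ 2 = s y + δ := Real.sq_sqrt hy.le
      have d1 : HasDerivAt (fun t => t + δ) 1 (s y) := (hasDerivAt_id _).add_const _
      have d2 := (hasDerivAt_const (s y) (-1 : ℝ)).div d1 hy.ne'
      have d3 := (hasDerivAt_const (s y) K).div ((d1.sqrt hy.ne').const_mul 2) (by positivity)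
      refine HasDerivAt.congr_deriv (f := fun t => n * (-1 / (t + δ) + K / (2 * √(t + δ))))
        ((d2.add d3).const_mul (n : ℝ)) ?_
      rw [mul_pow, hy2]; congr 1; field_simp; ring
    · have : ∀ x, √(s x + δ) ≠ 0 := fun x => (Real.sqrt_pos.2 (hτ x)).ne'
      refine contDiff_const.mul (ContDiff.add ?_ ?_)
      · exact contDiff_const.div hsm fun x => (hτ x).ne'
      · exact contDiff_const.div (by fun_prop) fun x => mul_ne_zero two_ne_zero (this x)

set_option maxHeartbeats 1600000 in
theorem eventually_eq_zero_of_first_order {q r F G : ℝ × ℝ → ℝ} (hq : ContDiff ℝ ∞ q)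
    (hr : ContDiff ℝ ∞ r) (hF : ContDiff ℝ ∞ F) (hG : ContDiff ℝ ∞ G) (hr0 : ∀ x, 0 < r x)
    {p : ℝ × ℝ} {c : ℝ}
    (hL : ∀ᶠ x in 𝓝 p, |q x * pd 0 F x + r x * pd 1 F x + pd 0 G x| ≤ c * (|F x| + |G x|) ∧
      |q x * pd 0 G x + r x * pd 1 G x - pd 0 F x| ≤ c * (|F x| + |G x|))
    (hFf : ∀ n, Flat p n F) (hGf : ∀ n, Flat p n G) :
    ∀ᶠ x in 𝓝 p, F x = 0 ∧ G x = 0 := by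
  obtain ⟨s, m, C, hs, hsp, hm, hC, hlow, hT⟩ := exists_radial_weight hq hr hr0 p
  obtain ⟨K, hK⟩ : ∃ K, K = 2 * C + 2 := ⟨_, rfl⟩
  have hK0 : 0 < K := by rw [hK]; positivity
  have hs0 : ∀ x, 0 ≤ s x := fun x => le_trans (by positivity) (hlow x)
  obtain ⟨σ₀, hσ₀, hσ1, hσ2, hσ3⟩ : ∃ σ₀ : ℝ, 0 < σ₀ ∧ σ₀ ≤ 1 ∧ 3 * K * C * σ₀ ≤ 4 ∧
      K * σ₀ ≤ 1 := by
    refine ⟨1 / (1 + 3 * K * C + K), by positivity, ?_, ?_, ?_⟩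
    · rw [div_le_one (by positivity)]; nlinarith [mul_nonneg hK0.le hC]
    · rw [mul_one_div, div_le_iff₀ (by positivity)]; nlinarith [mul_nonneg hK0.le hC]
    · rw [mul_one_div, div_le_iff₀ (by positivity)]; nlinarith [mul_nonneg hK0.le hC]
  have hsmall : ∀ᶠ x in 𝓝 p, s x < σ₀ ^ 2 / 2 :=
    hs.continuous.continuousAt.eventually_lt_const (by rw [hsp]; positivity)
  obtain ⟨ε, hε, hball⟩ := Metric.eventually_nhds_iff_ball.1 (hL.and hsmall)
  obtain ⟨R, hR0, hR1, hRε⟩ : ∃ R : ℝ, 0 < R ∧ R ≤ 1 ∧ R < ε :=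
    ⟨min 1 (ε / 2), by positivity, min_le_left _ _, (min_le_right _ _).trans_lt (by linarith)⟩
  have hRb : Metric.closedBall p R ⊆ Metric.ball p ε := Metric.closedBall_subset_ball hRε
  obtain ⟨ρ, hρ0, hρσ, hρ⟩ : ∃ ρ : ℝ, 0 < ρ ∧ ρ ≤ σ₀ ^ 2 / 2 ∧ ∀ x, s x < ρ → ‖x - p‖ < R / 2 := by
    refine ⟨min (σ₀ ^ 2 / 2) (m * (R / 2) ^ 2), by positivity, min_le_left _ _, fun x hx => ?_⟩
    have h1 := (hlow x).trans_lt (hx.trans_le (min_le_right _ _))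
    exact lt_of_pow_lt_pow_left₀ 2 (by positivity) (lt_of_mul_lt_mul_left h1 hm.le)
  obtain ⟨ε', hε', hball'⟩ := Metric.eventually_nhds_iff_ball.1
    (hs.continuous.continuousAt.eventually_lt_const (show s p < ρ by rw [hsp]; exact hρ0))
  let χ : ContDiffBump p := ⟨R / 2, R, by positivity, by linarith⟩
  let θ : ContDiffBump p := ⟨ε' / 2, ε', by positivity, by linarith⟩
  have hχs : ContDiff ℝ ∞ χ := χ.contDiff
  have hθs : ContDiff ℝ ∞ θ := θ.contDiff
  have hθ : ∀ x, ρ ≤ s x → θ x = 0 := fun x hx => θ.zero_of_le_dist (by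
    change ε' ≤ dist x p
    by_contra! h
    exact absurd (hball' x h) (not_lt.2 hx))
  obtain ⟨f, hfd⟩ : ∃ f : ℝ × ℝ → ℝ, f = fun x => χ x * F x := ⟨_, rfl⟩
  obtain ⟨g, hgd⟩ : ∃ g : ℝ × ℝ → ℝ, g = fun x => χ x * G x := ⟨_, rfl⟩
  have hf : ContDiff ℝ ∞ f := by rw [hfd]; fun_prop
  have hg : ContDiff ℝ ∞ g := by rw [hgd]; fun_prop
  have hfc : HasCompactSupport f := by rw [hfd]; exact χ.hasCompactSupport.mul_right
  have hgc : HasCompactSupport g := by rw [hgd]; exact χ.hasCompactSupport.mul_right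
  have hout : ∀ x ∉ Metric.closedBall p R, f =ᶠ[𝓝 x] 0 ∧ g =ᶠ[𝓝 x] 0 := by
    intro x hx
    have : x ∉ tsupport χ := by rw [χ.tsupport_eq]; exact hx
    have h := notMem_tsupport_iff_eventuallyEq.1 this
    constructor
    · filter_upwards [h] with y hy; simp [hfd, hy]
    · filter_upwards [h] with y hy; simp [hgd, hy]
  have hin : ∀ x, s x < ρ → f =ᶠ[𝓝 x] F ∧ g =ᶠ[𝓝 x] G := by
    intro x hx
    have hx' : x ∈ Metric.ball p (R / 2) := by simpa [dist_eq_norm] using hρ x hx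
    have h := Metric.isOpen_ball.mem_nhds hx'
    constructor
    · filter_upwards [h] with y hy
      rw [hfd]; simp only
      rw [χ.one_of_mem_closedBall (Metric.ball_subset_closedBall hy), one_mul]
    · filter_upwards [h] with y hy
      rw [hgd]; simp only
      rw [χ.one_of_mem_closedBall (Metric.ball_subset_closedBall hy), one_mul]
  have hf0 := pd_contDiff hf 0
  have hf1 := pd_contDiff hf 1
  have hg0 := pd_contDiff hg 0
  have hg1 := pd_contDiff hg 1
  obtain ⟨N, hNd⟩ : ∃ N : ℝ × ℝ → ℝ, N = fun x => f x ^ 2 + g x ^ 2 := ⟨_, rfl⟩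
  have hN : ContDiff ℝ ∞ N := by rw [hNd]; fun_prop
  have hN0 : ∀ x, 0 ≤ N x := fun x => by rw [hNd]; positivity
  obtain ⟨H, hHd⟩ : ∃ H : ℝ × ℝ → ℝ, H = fun x =>
      ((q x * pd 0 f x + r x * pd 1 f x + pd 0 g x) ^ 2 +
      (q x * pd 0 g x + r x * pd 1 g x - pd 0 f x) ^ 2) / r x := ⟨_, rfl⟩
  have hH : ContDiff ℝ ∞ H := by
    rw [hHd]; exact ContDiff.div (by fun_prop) hr fun x => (hr0 x).ne'
  obtain ⟨B, hB⟩ :=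
    (isCompact_closedBall p R).exists_bound_of_continuousOn hH.continuous.continuousOn
  obtain ⟨c', hc'⟩ := (isCompact_closedBall p R).exists_bound_of_continuousOn
    (f := fun x => 1 / r x) (Continuous.continuousOn
      (continuous_const.div hr.continuous fun x => (hr0 x).ne'))
  have hHN : ∀ x ∈ Metric.closedBall p R, s x < ρ → H x ≤ 4 * c ^ 2 * c' * N x := by
    intro x hx hxs
    obtain ⟨⟨e1, e2⟩, -⟩ := hball x (hRb hx)
    have hfx := (hin x hxs).1
    have hgx := (hin x hxs).2
    rw [hHd, hNd]
    simp only
    rw [(hfx.pd 0).eq_of_nhds, (hfx.pd 1).eq_of_nhds, (hgx.pd 0).eq_of_nhds,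
      (hgx.pd 1).eq_of_nhds, hfx.eq_of_nhds, hgx.eq_of_nhds]
    have i1 := sq_le_sq' (abs_le.1 e1).1 (abs_le.1 e1).2
    have i2 := sq_le_sq' (abs_le.1 e2).1 (abs_le.1 e2).2
    have i3 : (|F x| + |G x|) ^ 2 ≤ 2 * (F x ^ 2 + G x ^ 2) := by
      nlinarith [sq_nonneg (|F x| - |G x|), sq_abs (F x), sq_abs (G x)]
    have i4 : 1 / r x ≤ c' := (le_abs_self _).trans (hc' x hx)
    rw [div_eq_mul_one_div]
    calc _ ≤ (4 * c ^ 2 * (F x ^ 2 + G x ^ 2)) * (1 / r x) := by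
          refine mul_le_mul_of_nonneg_right ?_ (by have := hr0 x; positivity)
          rw [mul_pow] at i1 i2
          nlinarith [mul_le_mul_of_nonneg_left i3 (sq_nonneg c)]
      _ ≤ (4 * c ^ 2 * (F x ^ 2 + G x ^ 2)) * c' := by gcongr
      _ = _ := by ring
  have hA : ∀ n : ℕ, ∃ A, 0 ≤ A ∧ ∀ x ∈ Metric.closedBall p R, N x ≤ A * s x ^ (2 * n + 2) := by
    intro n
    have hfl : ∀ k, Flat p k f := fun k => by
      rw [hfd]; exact Flat.mul_left hχs hF (hFf k)
    have hgl : ∀ k, Flat p k g := fun k => by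
      rw [hgd]; exact Flat.mul_left hχs hG (hGf k)
    have hNl : Flat p (2 * (2 * n + 2)) N := by
      rw [hNd]
      simp only [pow_two]
      exact Flat.add (hf.mul hf) (hg.mul hg) (Flat.mul_left hf hf (hfl _))
        (Flat.mul_left hg hg (hgl _))
    obtain ⟨A, hA0, hA⟩ := hNl.exists_bound hN R
    refine ⟨A / m ^ (2 * n + 2), by positivity, fun x hx => ?_⟩
    calc N x ≤ A * ‖x - p‖ ^ (2 * (2 * n + 2)) := (le_abs_self _).trans (hA x hx)
      _ = A / m ^ (2 * n + 2) * (m * ‖x - p‖ ^ 2) ^ (2 * n + 2) := by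
          rw [mul_pow, pow_mul]; field_simp
      _ ≤ _ := by gcongr; exact hlow x
  set J := ∫ x, θ x * N x with hJ
  obtain ⟨V, hV⟩ : ∃ V, V = (volume (Metric.closedBall p R)).toReal := ⟨_, rfl⟩
  have hθNi : Integrable fun x => θ x * N x :=
    (hθs.continuous.mul hN.continuous).integrable_of_hasCompactSupport θ.hasCompactSupport.mul_right
  have main : ∀ n : ℕ, 4 * c ^ 2 * c' ≤ n → (n : ℝ) * J ≤ (|B| + 1) * V := by
    intro n hn
    obtain ⟨A, hA0, hAN⟩ := hA n
    obtain ⟨A', hA'⟩ : ∃ A', A' = A * Real.exp (2 * (n * K)) := ⟨_, rfl⟩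
    have hA'0 : 0 ≤ A' := by rw [hA']; positivity
    obtain ⟨δ, hδ, hδσ, hδA⟩ : ∃ δ : ℝ, 0 < δ ∧ δ ≤ σ₀ ^ 2 / 2 ∧ 8 * n * A' * δ ≤ 1 := by
      refine ⟨min (σ₀ ^ 2 / 2) (1 / (8 * n * A' + 1)), by positivity, min_le_left _ _, ?_⟩
      calc 8 * n * A' * min (σ₀ ^ 2 / 2) (1 / (8 * n * A' + 1))
          ≤ 8 * n * A' * (1 / (8 * n * A' + 1)) := by gcongr; exact min_le_right _ _
        _ ≤ 1 := by rw [mul_one_div, div_le_one (by positivity)]; linarith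
    obtain ⟨ψ, hψ, hψ1, hψ2, hψ3, hψ4⟩ := exists_carleman_weight hq hr hs hr0 hs0 hC hK hσ₀ hσ1
      hσ2 hσ3 hρ0 hρσ hδ hδσ n
    have hcarl := carleman hq hr hψ hf hg hr0 hfc hgc
    obtain ⟨I, hId⟩ : ∃ I : ℝ × ℝ → ℝ, I = fun x =>
      Real.exp (2 * ψ x) * (H x - 2 * N x * weightDiv q r ψ x) := ⟨_, rfl⟩
    have hI : 0 ≤ ∫ x, I x := by rw [hId, hHd, hNd]; exact hcarl
    have hIout : ∀ x ∉ Metric.closedBall p R, I x = 0 ∧ N x = 0 := by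
      intro x hx
      obtain ⟨h1, h2⟩ := hout x hx
      have z : ∀ i, pd i (0 : ℝ × ℝ → ℝ) x = 0 := fun i => pd_const 0 i x
      have hH0 : H x = 0 := by
        rw [hHd]
        simp only
        rw [(h1.pd 0).eq_of_nhds, (h1.pd 1).eq_of_nhds, (h2.pd 0).eq_of_nhds,
          (h2.pd 1).eq_of_nhds, z, z]
        simp
      have hN00 : N x = 0 := by
        rw [hNd]; simp [h1.eq_of_nhds, h2.eq_of_nhds]
      exact ⟨by rw [hId]; simp [hH0, hN00], hN00⟩
    have hIc : Continuous I := by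
      have := (weightDiv_contDiff hq hr hψ hr0).continuous
      have := hψ.continuous
      have := hH.continuous
      have := hN.continuous
      rw [hId]; fun_prop
    have hIi : Integrable I := hIc.integrable_of_hasCompactSupport
      (HasCompactSupport.intro (isCompact_closedBall p R) fun x hx => (hIout x hx).1)
    have hbnd : ∀ x, I x ≤ -(n * (θ x * N x)) +
        (Metric.closedBall p R).indicator (fun _ => |B| + 1) x := by
      intro x
      by_cases hx : x ∈ Metric.closedBall p R
      swap
      · rw [indicator_of_notMem hx, (hIout x hx).1, (hIout x hx).2]; simp
      rw [indicator_of_mem hx]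
      have hsx : s x ≤ σ₀ ^ 2 / 2 := (hball x (hRb hx)).2.le
      have hTx := hT x (Metric.closedBall_subset_closedBall hR1 hx)
      have hW := hψ4 x hsx hTx.1 hTx.2
      have hτ : 0 < s x + δ := by have := hs0 x; positivity
      have hE := Real.exp_pos (2 * ψ x)
      have hNx := hN0 x
      have hn0 : (0 : ℝ) ≤ n := n.cast_nonneg
      have hEN : Real.exp (2 * ψ x) * N x ≤ A' * (s x + δ) ^ 2 := by
        calc Real.exp (2 * ψ x) * N x ≤ Real.exp (2 * ψ x) * (A * s x ^ (2 * n + 2)) := by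
              gcongr; exact hAN x hx
          _ ≤ Real.exp (2 * ψ x) * (A * (s x + δ) ^ (2 * n + 2)) := by
              gcongr
              · exact hs0 x
              · linarith
          _ = A * (Real.exp (2 * ψ x) * (s x + δ) ^ (2 * n)) * (s x + δ) ^ 2 := by
              rw [pow_add]; ring
          _ ≤ A * Real.exp (2 * (n * K)) * (s x + δ) ^ 2 := by gcongr; exact hψ3 x hsx
          _ = _ := by rw [hA']
      have hEN2 : Real.exp (2 * ψ x) * N x * (8 * n * δ / (s x + δ) ^ 2) ≤ 1 := by
        calc _ ≤ A' * (s x + δ) ^ 2 * (8 * n * δ / (s x + δ) ^ 2) := by gcongr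
          _ = 8 * n * A' * δ := by field_simp
          _ ≤ 1 := hδA
      have hI1 : I x ≤ Real.exp (2 * ψ x) * (H x - 2 * n * N x) + 1 := by
        have : Real.exp (2 * ψ x) * N x * (n * (1 - 4 * δ / (s x + δ) ^ 2)) ≤
            Real.exp (2 * ψ x) * N x * weightDiv q r ψ x := by gcongr
        rw [hId]
        simp only
        have e : Real.exp (2 * ψ x) * N x * (8 * n * δ / (s x + δ) ^ 2) =
          2 * (Real.exp (2 * ψ x) * N x * (n * (4 * δ / (s x + δ) ^ 2))) := by ring
        linarith
      have hBx : H x ≤ |B| := (le_abs_self _).trans ((hB x hx).trans (le_abs_self _))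
      refine hI1.trans ?_
      rcases lt_or_ge (s x) ρ with hlt | hge
      · have h1 : H x ≤ n * N x := (hHN x hx hlt).trans (by gcongr)
        have h2 : 1 ≤ Real.exp (2 * ψ x) := Real.one_le_exp (by linarith [hψ1 x hlt.le])
        have h3 : θ x * N x ≤ N x := mul_le_of_le_one_left hNx θ.le_one
        have h4 : Real.exp (2 * ψ x) * (H x - 2 * n * N x) ≤ -(n * N x) := by
          have h5 : 0 ≤ n * N x := by positivity
          nlinarith
        have h6 : n * (θ x * N x) ≤ n * N x := by gcongr
        linarith [abs_nonneg B]
      · have h2 : Real.exp (2 * ψ x) ≤ 1 := Real.exp_le_one_iff.2 (by linarith [hψ2 x hge hsx])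
        rw [hθ x hge]
        have h5 : 0 ≤ n * N x := by positivity
        have h6 : Real.exp (2 * ψ x) * (H x - 2 * n * N x) ≤ 1 * |B| := by
          calc _ ≤ Real.exp (2 * ψ x) * |B| := by gcongr; linarith
            _ ≤ 1 * |B| := by gcongr
        linarith
    have hVf : volume (Metric.closedBall p R) ≠ ⊤ := measure_closedBall_lt_top.ne
    have hind : Integrable ((Metric.closedBall p R).indicator fun _ => |B| + 1) :=
      (integrable_indicator_iff Metric.isClosed_closedBall.measurableSet).2
        (integrableOn_const hVf)
    have h := integral_mono hIi ((hθNi.const_mul (n : ℝ)).neg.add hind) hbnd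
    have h2 : ∫ x, ((-fun x => (n : ℝ) * (θ x * N x)) + (Metric.closedBall p R).indicator
        fun _ => |B| + 1) x = -(n * J) + (|B| + 1) * V := by
      rw [integral_add' (hθNi.const_mul (n : ℝ)).neg hind,
        integral_indicator Metric.isClosed_closedBall.measurableSet, setIntegral_const]
      simp only [Pi.neg_apply]
      rw [integral_neg, integral_const_mul, ← hJ, hV, smul_eq_mul, mul_comm (|B| + 1)]
      rfl
    linarith
  have hJ0 : J ≤ 0 := by
    by_contra! hJp
    obtain ⟨n, hn⟩ := exists_nat_gt (max (4 * c ^ 2 * c') ((|B| + 1) * V / J))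
    have h1 := main n ((le_max_left _ _).trans hn.le)
    have h2 := (le_max_right _ _).trans_lt hn
    rw [div_lt_iff₀ hJp] at h2
    linarith
  have hzero : ∀ x, θ x * N x = 0 := by
    by_contra! hne
    obtain ⟨x, hx⟩ := hne
    have := (hθs.continuous.mul hN.continuous).integral_pos_of_hasCompactSupport_nonneg_nonzero
      (μ := volume) θ.hasCompactSupport.mul_right (fun y => mul_nonneg θ.nonneg (hN0 y)) hx
    exact absurd this (not_lt.2 hJ0)
  have hsρ : ∀ᶠ x in 𝓝 p, s x < ρ :=
    hs.continuous.continuousAt.eventually_lt_const (by rw [hsp]; exact hρ0)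
  filter_upwards [hsρ, θ.eventuallyEq_one] with x hx hx1
  have h1 := hzero x
  rw [hx1, Pi.one_apply, one_mul, hNd] at h1
  simp only at h1
  rw [(hin x hx).1.eq_of_nhds, (hin x hx).2.eq_of_nhds] at h1
  constructor <;> nlinarith [sq_nonneg (F x), sq_nonneg (G x)]

theorem fderiv_eq_zero_of_pd {f : ℝ × ℝ → ℝ} {x : ℝ × ℝ} (h : ∀ i, pd i f x = 0) :
    fderiv ℝ f x = 0 := by
  have h0 : fderiv ℝ f x (1, 0) = 0 := by simpa [pd] using h 0
  have h1 : fderiv ℝ f x (0, 1) = 0 := by simpa [pd] using h 1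
  ext
  · simpa using h0
  · simpa using h1

theorem eventually_eq_zero_of_pd {u : ℝ × ℝ → ℝ} (hu : ContDiff ℝ ∞ u) {p : ℝ × ℝ} (hp : u p = 0)
    (h : ∀ᶠ x in 𝓝 p, ∀ i, pd i u x = 0) : u =ᶠ[𝓝 p] 0 := by
  obtain ⟨ε, hε, hball⟩ := Metric.eventually_nhds_iff_ball.1 h
  filter_upwards [Metric.ball_mem_nhds p hε] with x hx
  have := (convex_ball p ε).is_const_of_fderivWithin_eq_zero (𝕜 := ℝ)
    (hu.differentiable (by simp)).differentiableOn (fun y hy => by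
      rw [fderivWithin_of_isOpen Metric.isOpen_ball hy]
      exact fderiv_eq_zero_of_pd (hball y hy)) hx (Metric.mem_ball_self hε)
  rw [this, hp, Pi.zero_apply]

theorem eventuallyEq_zero_of_flat {q r d u : ℝ × ℝ → ℝ} (hq : ContDiff ℝ ∞ q)
    (hr : ContDiff ℝ ∞ r) (hd : ContDiff ℝ ∞ d) (hu : ContDiff ℝ ∞ u) (hr0 : ∀ x, 0 < r x)
    (hd0 : ∀ x, 0 < d x) {p : ℝ × ℝ}
    (hL : ∀ᶠ x in 𝓝 p,
      pd 0 (fun y => d y * ((1 + q y ^ 2) / r y * pd 0 u y + q y * pd 1 u y)) x +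
        pd 1 (fun y => d y * (q y * pd 0 u y + r y * pd 1 u y)) x = 0)
    (hflat : ∀ n, Flat p n u) : u =ᶠ[𝓝 p] 0 := by
  have hu0 := pd_contDiff hu 0
  have hu1 := pd_contDiff hu 1
  obtain ⟨G, hGd⟩ : ∃ G, G = pd 0 u := ⟨_, rfl⟩
  obtain ⟨F, hFd⟩ : ∃ F : ℝ × ℝ → ℝ, F = fun x => q x * pd 0 u x + r x * pd 1 u x := ⟨_, rfl⟩
  obtain ⟨e, hed⟩ : ∃ e : ℝ × ℝ → ℝ, e = fun x => 1 / r x := ⟨_, rfl⟩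
  have he : ContDiff ℝ ∞ e := by
    rw [hed]; exact contDiff_const.div hr fun x => (hr0 x).ne'
  have hre : ∀ x, r x * e x = 1 := fun x => by rw [hed]; exact mul_one_div_cancel (hr0 x).ne'
  have hG : ContDiff ℝ ∞ G := by rw [hGd]; exact hu0
  have hF : ContDiff ℝ ∞ F := by rw [hFd]; fun_prop
  have hu1F : pd 1 u = fun x => e x * (F x - q x * G x) := by
    ext x; rw [hFd, hGd]; simp only; linear_combination (-pd 1 u x) * hre x
  have hGf : ∀ n, Flat p n G := fun n => by rw [hGd]; exact (hflat (n + 1)).2 0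
  have hFf : ∀ n, Flat p n F := fun n => by
    rw [hFd]
    exact Flat.add (hq.mul hu0) (hr.mul hu1) (Flat.mul_left hq hu0 ((hflat (n + 1)).2 0))
      (Flat.mul_left hr hu1 ((hflat (n + 1)).2 1))
  have e1 : (fun y => d y * ((1 + q y ^ 2) / r y * pd 0 u y + q y * pd 1 u y)) =
      fun y => (d y * e y) * (G y + q y * F y) := by
    ext y; rw [hFd, hGd, hed]; simp only
    have := (hr0 y).ne'
    field_simp
    ring
  have e2 : (fun y => d y * (q y * pd 0 u y + r y * pd 1 u y)) = fun y => d y * F y := by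
    rw [hFd]
  have hF0 := pd_contDiff hF 0
  have hG0 := pd_contDiff hG 0
  have hde0 := pd_contDiff (hd.mul he) 0
  have he0 := pd_contDiff he 0
  have hd1 := pd_contDiff hd 1
  have hq0 := pd_contDiff hq 0
  have L2 : ∀ x, q x * pd 0 G x + r x * pd 1 G x - pd 0 F x =
      (r x * pd 0 e x) * F x + (-pd 0 q x - r x * pd 0 e x * q x) * G x := by
    intro x
    have h := pd_comm hu x
    rw [hu1F, pd_mul he (by fun_prop), pd_sub hF (by fun_prop), pd_mul hq hG, ← hGd] at h
    linear_combination (-r x) * h + (pd 0 F x - pd 0 q x * G x - q x * pd 0 G x) * hre x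
  have L1 : ∀ᶠ x in 𝓝 p, q x * pd 0 F x + r x * pd 1 F x + pd 0 G x =
      (-pd 0 q x - r x / d x * (pd 0 (fun y => d y * e y) x * q x + pd 1 d x)) * F x +
      (-(r x / d x) * pd 0 (fun y => d y * e y) x) * G x := by
    filter_upwards [hL] with x hx
    rw [e1, e2, pd_mul (hd.mul he) (by fun_prop), pd_add hG (by fun_prop), pd_mul hq hF,
      pd_mul hd hF] at hx
    have := (hd0 x).ne'
    field_simp
    linear_combination r x * hx - (d x * pd 0 G x + d x * pd 0 q x * F x + d x * q x * pd 0 F x) *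
      hre x
  have bdd : ∀ {k : ℝ × ℝ → ℝ}, Continuous k → ∀ᶠ x in 𝓝 p, |k x| ≤ |k p| + 1 := fun hk =>
    (hk.abs.continuousAt.eventually_lt_const (lt_add_one _)).mono fun _ h => h.le
  have hrd : ContDiff ℝ ∞ fun x => r x / d x := hr.div hd fun x => (hd0 x).ne'
  have b1 := bdd (k := fun x => r x * pd 0 e x) (by fun_prop)
  have b2 := bdd (k := fun x => -pd 0 q x - r x * pd 0 e x * q x) (by fun_prop)
  have b3 := bdd (k := fun x => -pd 0 q x - r x / d x * (pd 0 (fun y => d y * e y) x * q x +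
    pd 1 d x)) (ContDiff.continuous (n := ∞) (by fun_prop))
  have b4 := bdd (k := fun x => -(r x / d x) * pd 0 (fun y => d y * e y) x)
    (ContDiff.continuous (n := ∞) (by fun_prop))
  have lin : ∀ {k l b₁ b₂ c f g : ℝ}, |k| ≤ b₁ → |l| ≤ b₂ → b₁ ≤ c → b₂ ≤ c →
      |k * f + l * g| ≤ c * (|f| + |g|) := by
    intro k l b₁ b₂ c f g h1 h2 h3 h4
    refine (abs_add_le _ _).trans ?_
    rw [abs_mul, abs_mul, mul_add]
    exact add_le_add (mul_le_mul_of_nonneg_right (h1.trans h3) (abs_nonneg _))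
      (mul_le_mul_of_nonneg_right (h2.trans h4) (abs_nonneg _))
  obtain ⟨c, c1, c2, c3, c4⟩ : ∃ c : ℝ, _ ≤ c ∧ _ ≤ c ∧ _ ≤ c ∧ _ ≤ c :=
    ⟨max (max _ _) (max _ _), (le_max_left _ _).trans (le_max_left _ _),
      (le_max_right _ _).trans (le_max_left _ _), (le_max_left _ _).trans (le_max_right _ _),
      (le_max_right _ _).trans (le_max_right _ _)⟩
  have key := eventually_eq_zero_of_first_order hq hr hF hG hr0 (c := c) (by
    filter_upwards [L1, b1, b2, b3, b4] with x l1 k1 k2 k3 k4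
    rw [l1, L2]
    exact ⟨lin k3 k4 c3 c4, lin k1 k2 c1 c2⟩) hFf hGf
  refine eventually_eq_zero_of_pd hu (hflat 1).1 ?_
  filter_upwards [key] with x hx
  rw [Fin.forall_fin_two]
  refine ⟨by rw [← hGd]; exact hx.2, ?_⟩
  rw [hu1F]
  simp [hx.1, hx.2]

theorem exists_normal_form {Ω : Set (ℝ × ℝ)} (hΩ : IsOpen Ω) {a : Fin 2 → Fin 2 → ℝ × ℝ → ℝ}
    (ha : ∀ i j, ContDiffOn ℝ ∞ (a i j) Ω) (hsym : ∀ i j, ∀ p ∈ Ω, a i j p = a j i p)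
    (hpos : ∀ p ∈ Ω, ∀ ξ : Fin 2 → ℝ, ξ ≠ 0 → 0 < ∑ i, ∑ j, a i j p * ξ i * ξ j)
    {p : ℝ × ℝ} (hp : p ∈ Ω) :
    ∃ q r d : ℝ × ℝ → ℝ, ContDiff ℝ ∞ q ∧ ContDiff ℝ ∞ r ∧ ContDiff ℝ ∞ d ∧ (∀ x, 0 < r x) ∧
      (∀ x, 0 < d x) ∧ ∀ᶠ x in 𝓝 p, a 0 0 x = d x * ((1 + q x ^ 2) / r x) ∧
        a 0 1 x = d x * q x ∧ a 1 0 x = d x * q x ∧ a 1 1 x = d x * r x := by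
  have hc : ∀ x ∈ Ω, 0 < a 1 1 x := fun x hx => by
    have := hpos x hx ![0, 1] (fun h => by simpa using congrFun h 1)
    simpa [Fin.sum_univ_two] using this
  have hdet : ∀ x ∈ Ω, 0 < a 0 0 x * a 1 1 x - a 0 1 x ^ 2 := fun x hx => by
    have h := hpos x hx ![a 1 1 x, -a 0 1 x] (fun h => (hc x hx).ne' (by simpa using congrFun h 0))
    simp only [Fin.sum_univ_two, Matrix.cons_val_zero, Matrix.cons_val_one] at h
    rw [hsym 1 0 x hx] at h
    have : 0 < a 1 1 x * (a 0 0 x * a 1 1 x - a 0 1 x ^ 2) := by linarith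
    exact (mul_pos_iff_of_pos_left (hc x hx)).1 this
  obtain ⟨d', hd'⟩ : ∃ d' : ℝ × ℝ → ℝ, d' = fun x => √(a 0 0 x * a 1 1 x - a 0 1 x ^ 2) := ⟨_, rfl⟩
  have hd'p : ∀ x ∈ Ω, 0 < d' x := fun x hx => by rw [hd']; exact Real.sqrt_pos.2 (hdet x hx)
  have hd's : ContDiffOn ℝ ∞ d' Ω := by
    rw [hd']
    exact ((((ha 0 0).mul (ha 1 1)).sub ((ha 0 1).pow 2))).sqrt fun x hx => (hdet x hx).ne'
  have hd'sq : ∀ x ∈ Ω, d' x ^ 2 = a 0 0 x * a 1 1 x - a 0 1 x ^ 2 := fun x hx => by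
    rw [hd']; exact Real.sq_sqrt (hdet x hx).le
  obtain ⟨ld, hld, eld⟩ := exists_contDiff_eventuallyEq hΩ
    (hd's.log fun x hx => (hd'p x hx).ne') hp
  obtain ⟨lr, hlr, elr⟩ := exists_contDiff_eventuallyEq hΩ
    (((ha 1 1).div hd's fun x hx => (hd'p x hx).ne').log
      fun x hx => (div_pos (hc x hx) (hd'p x hx)).ne') hp
  obtain ⟨q, hq, eq⟩ := exists_contDiff_eventuallyEq hΩ
    ((ha 0 1).div hd's fun x hx => (hd'p x hx).ne') hp
  refine ⟨q, fun x => Real.exp (lr x), fun x => Real.exp (ld x), hq, hlr.exp, hld.exp,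
    fun x => Real.exp_pos _, fun x => Real.exp_pos _, ?_⟩
  filter_upwards [eld, elr, eq, hΩ.mem_nhds hp] with x h1 h2 h3 hx
  have hcx := hc x hx
  have hdx := hd'p x hx
  rw [h1, h2, h3, Pi.div_apply, Pi.div_apply, Real.exp_log hdx, Real.exp_log (div_pos hcx hdx),
    hsym 1 0 x hx]
  refine ⟨?_, ?_, ?_, ?_⟩
  · field_simp; linear_combination -hd'sq x hx
  all_goals field_simp

theorem eventuallyEq_zero_of_harmonic {Ω : Set (ℝ × ℝ)} (hΩ : IsOpen Ω)
    {a : Fin 2 → Fin 2 → ℝ × ℝ → ℝ}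
    (ha : ∀ i j, ContDiffOn ℝ ∞ (a i j) Ω) (hsym : ∀ i j, ∀ p ∈ Ω, a i j p = a j i p)
    (hpos : ∀ p ∈ Ω, ∀ ξ : Fin 2 → ℝ, ξ ≠ 0 → 0 < ∑ i, ∑ j, a i j p * ξ i * ξ j)
    {p : ℝ × ℝ} (hp : p ∈ Ω) {u : ℝ × ℝ → ℝ} (hu : ContDiff ℝ ∞ u)
    (hL : ∀ᶠ x in 𝓝 p, ∑ i, pd i (fun y => ∑ j, a i j y * pd j u y) x = 0)
    (hflat : ∀ n, Flat p n u) : u =ᶠ[𝓝 p] 0 := by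
  obtain ⟨q, r, d, hq, hr, hd, hr0, hd0, h⟩ := exists_normal_form hΩ ha hsym hpos hp
  refine eventuallyEq_zero_of_flat hq hr hd hu hr0 hd0 ?_ hflat
  have e0 : (fun y => ∑ j, a 0 j y * pd j u y) =ᶠ[𝓝 p]
      fun y => d y * ((1 + q y ^ 2) / r y * pd 0 u y + q y * pd 1 u y) := by
    filter_upwards [h] with y hy
    rw [Fin.sum_univ_two, hy.1, hy.2.1]; ring
  have e1 : (fun y => ∑ j, a 1 j y * pd j u y) =ᶠ[𝓝 p]
      fun y => d y * (q y * pd 0 u y + r y * pd 1 u y) := by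
    filter_upwards [h] with y hy
    rw [Fin.sum_univ_two, hy.2.2.1, hy.2.2.2]; ring
  filter_upwards [hL, e0.pd 0, e1.pd 1] with x h1 h2 h3
  rw [← h2, ← h3, ← h1, Fin.sum_univ_two]

theorem harmonic_congr {a : Fin 2 → Fin 2 → ℝ × ℝ → ℝ} {u v : ℝ × ℝ → ℝ} {p : ℝ × ℝ}
    (h : u =ᶠ[𝓝 p] v) : (fun x => ∑ i, pd i (fun y => ∑ j, a i j y * pd j u y) x) =ᶠ[𝓝 p]
      fun x => ∑ i, pd i (fun y => ∑ j, a i j y * pd j v y) x := by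
  have e : ∀ i, (fun y => ∑ j, a i j y * pd j u y) =ᶠ[𝓝 p] fun y => ∑ j, a i j y * pd j v y := by
    intro i
    filter_upwards [h.pd 0, h.pd 1] with y h0 h1
    rw [Fin.sum_univ_two, Fin.sum_univ_two, h0, h1]
  filter_upwards [(e 0).pd 0, (e 1).pd 1] with x h0 h1
  rw [Fin.sum_univ_two, Fin.sum_univ_two, h0, h1]

theorem eqOn_zero_of_harmonic {Ω : Set (ℝ × ℝ)} (hΩ : IsOpen Ω) (hconn : IsConnected Ω)
    {a : Fin 2 → Fin 2 → ℝ × ℝ → ℝ}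
    (ha : ∀ i j, ContDiffOn ℝ ∞ (a i j) Ω) (hsym : ∀ i j, ∀ p ∈ Ω, a i j p = a j i p)
    (hpos : ∀ p ∈ Ω, ∀ ξ : Fin 2 → ℝ, ξ ≠ 0 → 0 < ∑ i, ∑ j, a i j p * ξ i * ξ j)
    {u : ℝ × ℝ → ℝ} (hu : ContDiffOn ℝ ∞ u Ω)
    (hL : ∀ x ∈ Ω, ∑ i, pd i (fun y => ∑ j, a i j y * pd j u y) x = 0)
    {p : ℝ × ℝ} (hp : p ∈ Ω) (h0 : u =ᶠ[𝓝 p] 0) : ∀ x ∈ Ω, u x = 0 := by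
  have hZo : IsOpen {x | u =ᶠ[𝓝 x] 0} := isOpen_setOfPred_eventually_nhds
  have hsub : Ω ⊆ {x | u =ᶠ[𝓝 x] 0} := by
    refine hconn.isPreconnected.subset_of_closure_inter_subset hZo ⟨p, hp, h0⟩ ?_
    rintro x ⟨hxc, hx⟩
    obtain ⟨v, hv, ev⟩ := exists_contDiff_eventuallyEq hΩ hu hx
    refine ev.symm.trans (eventuallyEq_zero_of_harmonic hΩ ha hsym hpos hx hv ?_ fun n => ?_)
    · filter_upwards [harmonic_congr (a := a) ev, hΩ.mem_nhds hx] with y hy hyΩ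
      rw [hy, hL y hyΩ]
    · obtain ⟨W, hW, hWo, hxW⟩ := eventually_nhds_iff.1 ev
      refine Flat.of_mem_closure (S := W ∩ {x | u =ᶠ[𝓝 x] 0}) hv ?_ ?_ n
      · rintro y ⟨hyW, hy⟩
        refine EventuallyEq.trans ?_ hy
        filter_upwards [hWo.mem_nhds hyW] with z hz using hW z hz
      · exact hWo.inter_closure ⟨hxW, hxc⟩
  exact fun x hx => (hsub hx).eq_of_nhds

theorem pd_const_mul {f : ℝ × ℝ → ℝ} (hf : ContDiff ℝ ∞ f) (c : ℝ) (i : Fin 2) :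
    pd i (fun x => c * f x) = fun x => c * pd i f x := by
  ext x
  rw [pd_mul contDiff_const hf, pd_const, zero_mul, zero_add]

theorem iterate_pd_linear {f g : ℝ × ℝ → ℝ} (hf : ContDiff ℝ ∞ f) (hg : ContDiff ℝ ∞ g) (a b : ℝ)
    (i : Fin 2) (n : ℕ) : (pd i)^[n] (fun x => a * f x + b * g x) =
      fun x => a * (pd i)^[n] f x + b * (pd i)^[n] g x := by
  induction n generalizing f g with
  | zero => rfl
  | succ n ih =>
    rw [Function.iterate_succ_apply, Function.iterate_succ_apply, Function.iterate_succ_apply,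
      ← ih (pd_contDiff hf i) (pd_contDiff hg i)]
    congr 1
    ext x
    rw [pd_add (by fun_prop) (by fun_prop), pd_const_mul hf, pd_const_mul hg]

/-- The constant coefficient operator `a ∂₀∂₀ + b ∂₀∂₁ + c ∂₁∂₁`. -/
noncomputable def secondOrder (a b c : ℝ) (f : ℝ × ℝ → ℝ) (x : ℝ × ℝ) : ℝ :=
  a * pd 0 (pd 0 f) x + b * pd 0 (pd 1 f) x + c * pd 1 (pd 1 f) x

theorem secondOrder_contDiff {f : ℝ × ℝ → ℝ} (hf : ContDiff ℝ ∞ f) (a b c : ℝ) :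
    ContDiff ℝ ∞ (secondOrder a b c f) := by
  have h00 := pd_contDiff (pd_contDiff hf 0) 0
  have h01 := pd_contDiff (pd_contDiff hf 1) 0
  have h11 := pd_contDiff (pd_contDiff hf 1) 1
  unfold secondOrder
  fun_prop

theorem pd_secondOrder {f : ℝ × ℝ → ℝ} (hf : ContDiff ℝ ∞ f) (a b c : ℝ) (i : Fin 2) :
    pd i (secondOrder a b c f) = secondOrder a b c (pd i f) := by
  have comm : ∀ {f : ℝ × ℝ → ℝ}, ContDiff ℝ ∞ f → ∀ j, pd i (pd j f) = pd j (pd i f) := by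
    intro f hf j
    ext x
    have := pd_comm hf x
    fin_cases i <;> fin_cases j <;> simp [this]
  have h0 := pd_contDiff hf 0
  have h1 := pd_contDiff hf 1
  have h00 := pd_contDiff h0 0
  have h01 := pd_contDiff h1 0
  have h11 := pd_contDiff h1 1
  ext x
  unfold secondOrder
  rw [pd_add (by fun_prop) (by fun_prop), pd_add (by fun_prop) (by fun_prop), pd_const_mul h00,
    pd_const_mul h01, pd_const_mul h11, comm h0, comm h1, comm h1, comm hf, comm hf]

theorem Flat.succ_of_secondOrder {f : ℝ × ℝ → ℝ} (hf : ContDiff ℝ ∞ f) {a b c : ℝ} (hc : c ≠ 0)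
    {p : ℝ × ℝ} {m : ℕ} (h : Flat p (m + 1) f) (hL : Flat p m (secondOrder a b c f))
    (h0 : (pd 0)^[m + 1] f p = 0) (h1 : (pd 0)^[m] (pd 1 f) p = 0) : Flat p (m + 2) f := by
  induction m generalizing f with
  | zero => exact ⟨h.1, Fin.forall_fin_two.2 ⟨⟨h0, fun _ => trivial⟩, ⟨h1, fun _ => trivial⟩⟩⟩
  | succ m ih =>
    have hf0 := pd_contDiff hf 0
    have hf1 := pd_contDiff hf 1
    have h00 := pd_contDiff hf0 0
    have h01 := pd_contDiff hf1 0
    have hcomm : pd 1 (pd 0 f) = pd 0 (pd 1 f) := funext fun x => (pd_comm hf x).symm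
    refine ⟨h.1, Fin.forall_fin_two.2 ⟨ih hf0 (h.2 0) ?_ h0 ?_, ih hf1 (h.2 1) ?_ h1 ?_⟩⟩
    · rw [← pd_secondOrder hf]; exact hL.2 0
    · rw [hcomm]; exact h1
    · rw [← pd_secondOrder hf]; exact hL.2 1
    · have e : pd 1 (pd 1 f) = fun x => (1 / c) * secondOrder a b c f x +
          (-1 / c) * (a * pd 0 (pd 0 f) x + b * pd 0 (pd 1 f) x) := by
        ext x; unfold secondOrder; field_simp; ring
      rw [e, iterate_pd_linear (secondOrder_contDiff hf a b c) (by fun_prop),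
        iterate_pd_linear h00 h01]
      have k1 : (pd 0)^[m] (pd 0 (pd 0 f)) p = 0 := h0
      have k2 : (pd 0)^[m] (pd 0 (pd 1 f)) p = 0 := h1
      simp only
      rw [k1, k2, hL.iterate_pd m.lt_succ_self]
      ring

theorem Flat.secondOrder_of_harmonic {a : Fin 2 → Fin 2 → ℝ × ℝ → ℝ}
    (ha : ∀ i j, ContDiff ℝ ∞ (a i j)) {u : ℝ × ℝ → ℝ} (hu : ContDiff ℝ ∞ u) {p : ℝ × ℝ}
    (hsym : a 1 0 p = a 0 1 p)
    (hL : ∀ᶠ x in 𝓝 p, ∑ i, pd i (fun y => ∑ j, a i j y * pd j u y) x = 0) {m : ℕ}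
    (h : Flat p (m + 1) u) :
    Flat p m (secondOrder (a 0 0 p) (2 * a 0 1 p) (a 1 1 p) u) := by
  have hu1 := fun i => pd_contDiff hu i
  have hu2 := fun i j => pd_contDiff (hu1 j) i
  have ha1 := fun i j k => pd_contDiff (ha i j) k
  have e : (fun x => -∑ i, ∑ j, ((a i j x - a i j p) * pd i (pd j u) x + pd i (a i j) x * pd j u x))
      =ᶠ[𝓝 p] secondOrder (a 0 0 p) (2 * a 0 1 p) (a 1 1 p) u := by
    filter_upwards [hL] with x hx
    have expand : ∀ i, pd i (fun y => ∑ j, a i j y * pd j u y) x =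
        ∑ j, (pd i (a i j) x * pd j u x + a i j x * pd i (pd j u) x) := by
      intro i
      simp only [Fin.sum_univ_two]
      rw [pd_add ((ha i 0).mul (hu1 0)) ((ha i 1).mul (hu1 1)), pd_mul (ha i 0) (hu1 0),
        pd_mul (ha i 1) (hu1 1)]
    rw [Fin.sum_univ_two, expand, expand] at hx
    simp only [Fin.sum_univ_two] at hx ⊢
    unfold secondOrder
    have hc := pd_comm hu x
    rw [hsym]
    linear_combination (-1) * hx - a 0 1 p * hc
  have hterm : ∀ i j, Flat p m
      (fun x => (a i j x - a i j p) * pd i (pd j u) x + pd i (a i j) x * pd j u x) := by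
    intro i j
    refine Flat.add (((ha i j).sub contDiff_const).mul (hu2 i j)) ((ha1 i j i).mul (hu1 j)) ?_
      (Flat.mul_left (ha1 i j i) (hu1 j) (h.2 j))
    refine Flat.mul (n := 1) (m := m - 1) ((ha i j).sub contDiff_const) (hu2 i j)
      ⟨sub_self _, fun _ => trivial⟩ ?_ (by omega)
    exact (h.2 j).pd_sub_one i
  have hs : ∀ i j, ContDiff ℝ ∞
      (fun x => (a i j x - a i j p) * pd i (pd j u) x + pd i (a i j) x * pd j u x) := fun i j =>
    (((ha i j).sub contDiff_const).mul (hu2 i j)).add ((ha1 i j i).mul (hu1 j))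
  refine Flat.congr e ?_
  have hrow : ∀ i, Flat p m (fun x => ∑ j,
      ((a i j x - a i j p) * pd i (pd j u) x + pd i (a i j) x * pd j u x)) := fun i => by
    simp only [Fin.sum_univ_two]
    exact Flat.add (hs i 0) (hs i 1) (hterm i 0) (hterm i 1)
  have hrows : ∀ i, ContDiff ℝ ∞ (fun x => ∑ j,
      ((a i j x - a i j p) * pd i (pd j u) x + pd i (a i j) x * pd j u x)) := fun i => by
    simp only [Fin.sum_univ_two]
    exact (hs i 0).add (hs i 1)
  have := Flat.mul_left (contDiff_const (c := (-1 : ℝ))) ((hrows 0).add (hrows 1))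
    (Flat.add (hrows 0) (hrows 1) (hrow 0) (hrow 1))
  refine Flat.congr (Eventually.of_forall fun x => ?_) this
  simp only [Fin.sum_univ_two]
  ring

/-- The real part of `κ (x + l y) ^ n`. -/
noncomputable def powRe (l κ : ℂ) (n : ℕ) (x : ℝ × ℝ) : ℝ :=
  (κ * ((x.1 : ℂ) + l * x.2) ^ n).re

theorem powRe_contDiff (l κ : ℂ) (n : ℕ) : ContDiff ℝ ∞ (powRe l κ n) := by
  have h1 : ContDiff ℝ ∞ fun x : ℝ × ℝ => (x.1 : ℂ) := Complex.ofRealCLM.contDiff.comp contDiff_fst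
  have h2 : ContDiff ℝ ∞ fun x : ℝ × ℝ => (x.2 : ℂ) := Complex.ofRealCLM.contDiff.comp contDiff_snd
  exact Complex.reCLM.contDiff.comp
    (contDiff_const.mul ((h1.add (contDiff_const.mul h2)).pow n))

theorem pd_powRe (l κ : ℂ) (n : ℕ) (i : Fin 2) :
    pd i (powRe l κ n) = powRe l (n * κ * if i = 0 then 1 else l) (n - 1) := by
  ext x
  have h1 : HasFDerivAt (fun x : ℝ × ℝ => (x.1 : ℂ) + l * x.2)
      (Complex.ofRealCLM.comp (ContinuousLinearMap.fst ℝ ℝ ℝ) +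
        l • Complex.ofRealCLM.comp (ContinuousLinearMap.snd ℝ ℝ ℝ)) x :=
    (Complex.ofRealCLM.hasFDerivAt.comp x hasFDerivAt_fst).add
      ((Complex.ofRealCLM.hasFDerivAt.comp x hasFDerivAt_snd).const_mul l)
  have h2 := Complex.reCLM.hasFDerivAt.comp x ((h1.pow n).const_mul κ)
  have h3 : HasFDerivAt (powRe l κ n) _ x := h2
  unfold pd
  rw [h3.fderiv]
  unfold powRe
  simp only [ContinuousLinearMap.comp_apply, smul_apply,
    add_apply, Complex.reCLM_apply, Complex.ofRealCLM_apply,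
    ContinuousLinearMap.coe_fst', ContinuousLinearMap.coe_snd', smul_eq_mul]
  congr 1
  split_ifs <;> simp <;> ring

theorem powRe_zero (l : ℂ) (n : ℕ) : powRe l 0 n = fun _ => 0 := by
  ext x; simp [powRe]

theorem iterate_pd_powRe (l κ : ℂ) (n : ℕ) (p : ℝ × ℝ) :
    (pd 0)^[n] (powRe l κ n) p = (n.factorial : ℝ) * κ.re := by
  induction n generalizing κ with
  | zero => simp [powRe]
  | succ n ih =>
    rw [Function.iterate_succ_apply, pd_powRe, if_pos rfl, Nat.add_sub_cancel, ih,
      Nat.factorial_succ]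
    rw [show ((n + 1 : ℕ) : ℂ) * κ * 1 = ((n + 1 : ℕ) : ℝ) * κ by push_cast; ring,
      Complex.re_ofReal_mul]
    push_cast; ring

theorem flat_powRe (l κ : ℂ) (n : ℕ) : Flat (0, 0) n (powRe l κ n) := by
  induction n generalizing κ with
  | zero => trivial
  | succ n ih => exact ⟨by simp [powRe], fun i => by rw [pd_powRe]; exact ih _⟩

theorem secondOrder_powRe {l : ℂ} {a b c : ℝ} (hl : a + b * l + c * l ^ 2 = 0) (κ : ℂ) (n : ℕ) :
    secondOrder a b c (powRe l κ n) = fun _ => 0 := by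
  ext x
  unfold secondOrder
  simp only [pd_powRe]
  unfold powRe
  rw [← Complex.re_ofReal_mul, ← Complex.re_ofReal_mul, ← Complex.re_ofReal_mul,
    ← Complex.add_re, ← Complex.add_re]
  rw [← Complex.zero_re]
  congr 1
  simp only [if_true, if_neg (one_ne_zero (α := Fin 2))]
  linear_combination (((n - 1 : ℕ) : ℂ) * (n * κ) * ((x.1 : ℂ) + l * x.2) ^ (n - 1 - 1)) * hl

theorem exists_leading_term {u : ℝ × ℝ → ℝ} (hu : ContDiff ℝ ∞ u) {l : ℂ} (hl0 : l.im ≠ 0)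
    {a b c : ℝ} (hc : c ≠ 0) (hl : a + b * l + c * l ^ 2 = 0) {m : ℕ} (h : Flat (0, 0) (m + 1) u)
    (h' : ¬ Flat (0, 0) (m + 2) u) (hL : Flat (0, 0) m (secondOrder a b c u)) :
    ∃ κ : ℂ, κ ≠ 0 ∧ Flat (0, 0) (m + 2) fun x => u x - powRe l κ (m + 1) x := by
  obtain ⟨κ, h1, h2⟩ : ∃ κ : ℂ, (((m + 1).factorial : ℕ) : ℝ) * κ.re = (pd 0)^[m + 1] u (0, 0) ∧
      (((m + 1).factorial : ℕ) : ℝ) * (κ * l).re = (pd 0)^[m] (pd 1 u) (0, 0) := by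
    have hm : (((m + 1).factorial : ℕ) : ℝ) ≠ 0 := by positivity
    refine ⟨⟨(pd 0)^[m + 1] u (0, 0) / (m + 1).factorial, ((pd 0)^[m + 1] u (0, 0) /
      (m + 1).factorial * l.re - (pd 0)^[m] (pd 1 u) (0, 0) / (m + 1).factorial) / l.im⟩, ?_, ?_⟩
    · field_simp
    · rw [Complex.mul_re]; field_simp; ring
  have hp := powRe_contDiff l κ (m + 1)
  have key : Flat (0, 0) (m + 2) fun x => u x - powRe l κ (m + 1) x := by
    have e : ∀ (f g : ℝ × ℝ → ℝ), (fun x => f x - g x) = fun x => 1 * f x + (-1) * g x :=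
      fun f g => by ext x; ring
    refine Flat.succ_of_secondOrder (hu.sub hp) hc (Flat.sub hu hp h (flat_powRe l κ _))
      (a := a) (b := b) ?_ ?_ ?_
    · refine Flat.congr (Eventually.of_forall fun x => ?_) hL
      have e' : secondOrder a b c (powRe l κ (m + 1)) x = 0 := by rw [secondOrder_powRe hl]
      have hu0 := pd_contDiff hu 0
      have hu1 := pd_contDiff hu 1
      have hp0 := pd_contDiff hp 0
      have hp1 := pd_contDiff hp 1
      have d : ∀ i, pd i (fun x => u x - powRe l κ (m + 1) x) =
        fun x => pd i u x - pd i (powRe l κ (m + 1)) x := fun i => funext fun x => pd_sub hu hp i x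
      unfold secondOrder at e' ⊢
      rw [d, d, pd_sub hu0 hp0, pd_sub hu1 hp1, pd_sub hu1 hp1]
      linear_combination e'
    · rw [e, iterate_pd_linear hu hp]
      simp only
      rw [iterate_pd_powRe, h1]; ring
    · have d : pd 1 (fun x => u x - powRe l κ (m + 1) x) =
        fun x => pd 1 u x - pd 1 (powRe l κ (m + 1)) x := funext fun x => pd_sub hu hp 1 x
      rw [d, e, iterate_pd_linear (pd_contDiff hu 1) (pd_contDiff hp 1), pd_powRe]
      simp only
      rw [Nat.add_sub_cancel, iterate_pd_powRe, ← h2, if_neg one_ne_zero, mul_assoc,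
        Nat.factorial_succ, ← Complex.ofReal_natCast, Complex.re_ofReal_mul]
      push_cast; ring
  refine ⟨κ, ?_, key⟩
  rintro rfl
  refine h' (Flat.congr (Eventually.of_forall fun x => ?_) key)
  rw [powRe_zero]; ring

open Polynomial ComplexConjugate in
theorem eq_of_forall_norm_eq_one_eval_eq {P Q : ℂ[X]} (h : ∀ w : ℂ, ‖w‖ = 1 → P.eval w = Q.eval w) :
    P = Q := by
  refine Polynomial.eq_of_infinite_eval_eq P Q (Set.Infinite.mono (s := Metric.sphere 0 1) ?_ ?_)
  · exact fun w hw => h w (by simpa using hw)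
  · refine (isPreconnected_sphere (by simp [Complex.rank_real_complex]) 0 1).infinite_of_nontrivial
      ⟨1, by simp, -1, by simp, ?_⟩
    norm_num

open Polynomial ComplexConjugate in
/-- On the unit circle, `2 Re (κ z ^ n) * z ^ n` is the value at `z ^ 2` of this polynomial. -/
noncomputable def circlePoly (κ : ℂ) (n : ℕ) : ℂ[X] := C κ * X ^ n + C (conj κ)

open Polynomial ComplexConjugate in
theorem circlePoly_eval {κ z : ℂ} {n : ℕ} (hz : ‖z‖ = 1) :
    (circlePoly κ n).eval (z ^ 2) = 2 * ((κ * z ^ n).re : ℂ) * z ^ n := by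
  have h1 : conj z * z = 1 := by
    rw [← Complex.normSq_eq_conj_mul_self, Complex.normSq_eq_norm_sq, hz]; simp
  have h2 : conj z ^ n * z ^ n = 1 := by rw [← mul_pow, h1, one_pow]
  rw [Complex.re_eq_add_conj]
  simp only [circlePoly, eval_add, eval_mul, eval_C, eval_pow, eval_X, map_mul, map_pow]
  linear_combination (-conj κ) * h2

open Polynomial ComplexConjugate in
theorem circlePoly_coeff {κ : ℂ} {n : ℕ} (k : ℕ) :
    (circlePoly κ n).coeff k = (if k = n then κ else 0) + if k = 0 then conj κ else 0 := by
  simp [circlePoly, coeff_X_pow, coeff_C]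

theorem circlePoly_ne_zero {κ : ℂ} (hκ : κ ≠ 0) {n : ℕ} (hn : n ≠ 0) : circlePoly κ n ≠ 0 := by
  intro h
  have := circlePoly_coeff (κ := κ) (n := n) 0
  rw [h, if_neg hn.symm] at this
  simp only [Polynomial.coeff_zero, if_true, zero_add] at this
  exact hκ ((map_eq_zero _).1 this.symm)

theorem exists_re_mul_pow_ne_zero {κ₁ κ₂ : ℂ} (h1 : κ₁ ≠ 0) (h2 : κ₂ ≠ 0) {m n : ℕ} (hm : m ≠ 0)
    (hn : n ≠ 0) : ∃ z : ℂ, (κ₁ * z ^ m).re * (κ₂ * z ^ n).re ≠ 0 := by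
  by_contra! h
  have : circlePoly κ₁ m * circlePoly κ₂ n = 0 := by
    refine eq_of_forall_norm_eq_one_eval_eq fun w hw => ?_
    obtain ⟨z, rfl⟩ := IsAlgClosed.exists_pow_nat_eq w two_pos
    have hz : ‖z‖ = 1 := by
      rw [norm_pow] at hw; exact (pow_eq_one_iff_of_nonneg (norm_nonneg z) two_ne_zero).1 hw
    rw [Polynomial.eval_mul, circlePoly_eval hz, circlePoly_eval hz, Polynomial.eval_zero]
    have : (((κ₁ * z ^ m).re : ℂ)) * ((κ₂ * z ^ n).re : ℂ) = 0 := by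
      rw [← Complex.ofReal_mul, h z, Complex.ofReal_zero]
    linear_combination (4 * z ^ m * z ^ n) * this
  rcases mul_eq_zero.1 this with h | h
  · exact circlePoly_ne_zero h1 hm h
  · exact circlePoly_ne_zero h2 hn h

open Polynomial ComplexConjugate in
theorem parallel_of_re_mul_pow {κ₁ κ₂ κ₃ κ₄ : ℂ} (h1 : κ₁ ≠ 0) (h2 : κ₂ ≠ 0) (h3 : κ₃ ≠ 0)
    (h4 : κ₄ ≠ 0) {a b c d : ℕ} (ha : a ≠ 0) (hb : b ≠ 0) (hc : c ≠ 0) (hd : d ≠ 0)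
    (hdeg : a + b = c + d)
    (h : ∀ z : ℂ, (κ₁ * z ^ a).re * (κ₂ * z ^ b).re = (κ₃ * z ^ c).re * (κ₄ * z ^ d).re) :
    (a = c ∧ (κ₁ * conj κ₃).im = 0) ∨ (b = c ∧ (κ₂ * conj κ₃).im = 0) := by
  have hP : circlePoly κ₁ a * circlePoly κ₂ b = circlePoly κ₃ c * circlePoly κ₄ d := by
    refine eq_of_forall_norm_eq_one_eval_eq fun w hw => ?_
    obtain ⟨z, rfl⟩ := IsAlgClosed.exists_pow_nat_eq w two_pos
    have hz : ‖z‖ = 1 := by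
      rw [norm_pow] at hw; exact (pow_eq_one_iff_of_nonneg (norm_nonneg z) two_ne_zero).1 hw
    rw [eval_mul, eval_mul, circlePoly_eval hz, circlePoly_eval hz, circlePoly_eval hz,
      circlePoly_eval hz]
    have h5 : (((κ₁ * z ^ a).re : ℂ)) * ((κ₂ * z ^ b).re : ℂ) =
        ((κ₃ * z ^ c).re : ℂ) * ((κ₄ * z ^ d).re : ℂ) := by
      rw [← Complex.ofReal_mul, h z, Complex.ofReal_mul]
    have h6 : z ^ a * z ^ b = z ^ c * z ^ d := by rw [← pow_add, hdeg, pow_add]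
    linear_combination (4 * z ^ a * z ^ b) * h5 +
      (4 * ((κ₃ * z ^ c).re : ℂ) * ((κ₄ * z ^ d).re : ℂ)) * h6
  have cf : ∀ k, (if k = a + b then κ₁ * κ₂ else 0) + (if k = a then κ₁ * conj κ₂ else 0) +
      (if k = b then κ₂ * conj κ₁ else 0) + (if k = 0 then conj κ₁ * conj κ₂ else 0) =
      (if k = c + d then κ₃ * κ₄ else 0) + (if k = c then κ₃ * conj κ₄ else 0) +
      (if k = d then κ₄ * conj κ₃ else 0) + (if k = 0 then conj κ₃ * conj κ₄ else 0) := by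
    intro k
    have e : ∀ (κ κ' : ℂ) (m n : ℕ), (circlePoly κ m * circlePoly κ' n).coeff k =
        (if k = m + n then κ * κ' else 0) + (if k = m then κ * conj κ' else 0) +
        (if k = n then κ' * conj κ else 0) + (if k = 0 then conj κ * conj κ' else 0) := by
      intro κ κ' m n
      have : circlePoly κ m * circlePoly κ' n = C (κ * κ') * X ^ (m + n) + C (κ * conj κ') * X ^ m +
          C (κ' * conj κ) * X ^ n + C (conj κ * conj κ') := by
        simp only [circlePoly, C_mul, pow_add]; ring
      rw [this]
      simp only [coeff_add, coeff_C_mul, coeff_X_pow, coeff_C, mul_ite, mul_one, mul_zero]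
    rw [← e, ← e, hP]
  have conj0 : ∀ {z w : ℂ}, conj z = conj w → z = w := fun h => (starRingEnd ℂ).injective h
  have c0 : conj κ₁ * conj κ₂ = conj κ₃ * conj κ₄ := by
    have := cf 0
    have hab : 0 ≠ a + b := by omega
    have hcd : 0 ≠ c + d := by omega
    simpa only [hab, hcd, ha.symm, hb.symm, hc.symm, hd.symm, if_false, if_true,
      zero_add] using this
  have c1 : κ₁ * κ₂ = κ₃ * κ₄ := conj0 (by simpa using c0)
  have imz : ∀ {z w : ℂ}, z * conj w = w * conj z → (z * conj w).im = 0 := by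
    intro z w h
    rw [← Complex.conj_eq_iff_im, map_mul, Complex.conj_conj, mul_comm, h]
  have hk1 : conj κ₁ ≠ 0 := by simpa using h1
  have hk2 : conj κ₂ ≠ 0 := by simpa using h2
  have hk3 : conj κ₃ ≠ 0 := by simpa using h3
  have hk4 : conj κ₄ ≠ 0 := by simpa using h4
  by_cases hac : a = c
  · subst hac
    have hbd : b = d := by omega
    subst hbd
    have ca := cf a
    simp only [left_eq_add, hb, ha, if_false, if_true, zero_add, add_zero] at ca
    by_cases hab : a = b
    · subst hab
      simp only [if_true] at ca
      have key : (κ₁ * conj κ₃ - κ₃ * conj κ₁) * (κ₂ * conj κ₃ - κ₃ * conj κ₂) = 0 := by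
        linear_combination (conj κ₃ ^ 2) * c1 + (κ₃ ^ 2) * c0 - (κ₃ * conj κ₃) * ca
      rcases mul_eq_zero.1 key with h | h
      · exact Or.inl ⟨rfl, imz (sub_eq_zero.1 h)⟩
      · exact Or.inr ⟨rfl, imz (sub_eq_zero.1 h)⟩
    · simp only [hab, if_false, add_zero] at ca
      have ca' : conj κ₁ * κ₂ = conj κ₃ * κ₄ := by
        have := congrArg conj ca; simpa using this
      refine Or.inl ⟨rfl, imz (mul_right_cancel₀ (mul_ne_zero h2 h4) ?_)⟩
      linear_combination (conj κ₃ * κ₄) * c1 - (κ₃ * κ₄) * ca'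
  · have cc := cf c
    have hcab : c ≠ a + b := by omega
    have hccd : c ≠ c + d := by omega
    simp only [hcab, hccd, hc, Ne.symm hac, if_false, if_true, zero_add, add_zero] at cc
    by_cases hbc : b = c
    · subst hbc
      have had : a = d := by omega
      subst had
      simp only [Ne.symm hac, if_false, if_true, add_zero] at cc
      refine Or.inr ⟨rfl, imz (mul_right_cancel₀ (mul_ne_zero hk1 hk4) ?_)⟩
      linear_combination (conj κ₃ * conj κ₄) * cc - (κ₃ * conj κ₄) * c0
    · exfalso
      simp only [Ne.symm hbc, if_false] at cc
      by_cases hcd : c = d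
      · subst hcd
        have hab : a ≠ b := by omega
        have ca := cf a
        have h5 : a ≠ a + b := by omega
        have h6 : a ≠ c + c := by omega
        simp only [h5, h6, hab, ha, hac, if_false, if_true, zero_add, add_zero] at ca
        exact mul_ne_zero h1 hk2 ca
      · simp [hcd, h3, h4] at cc

/-- Along each ray, `u` is asymptotic at the origin to `powRe l κ n`. -/
def Lead (l : ℂ) (n : ℕ) (κ : ℂ) (u : ℝ × ℝ → ℝ) : Prop :=
  ∀ x, Tendsto (fun t : ℝ => u (t • x) / t ^ n) (𝓝[>] 0) (𝓝 (powRe l κ n x))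

/-- Along each ray, `u` decays at the origin faster than any power. -/
def RayFlat (u : ℝ × ℝ → ℝ) : Prop :=
  ∀ (n : ℕ) (x : ℝ × ℝ), Tendsto (fun t : ℝ => u (t • x) / t ^ n) (𝓝[>] 0) (𝓝 0)

theorem tendsto_smul_nhdsGT_zero (x : ℝ × ℝ) :
    Tendsto (fun t : ℝ => t • x) (𝓝[>] 0) (𝓝 (0, 0)) := by
  have : Tendsto (fun t : ℝ => t • x) (𝓝 0) (𝓝 ((0 : ℝ) • x)) :=
    (continuous_id.smul continuous_const).tendsto 0
  rw [zero_smul] at this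
  exact this.mono_left nhdsWithin_le_nhds

theorem Flat.tendsto_div_pow {w : ℝ × ℝ → ℝ} (hw : ContDiff ℝ ∞ w) {n : ℕ}
    (h : Flat (0, 0) (n + 1) w) (x : ℝ × ℝ) :
    Tendsto (fun t : ℝ => w (t • x) / t ^ n) (𝓝[>] 0) (𝓝 0) := by
  obtain ⟨C, hC, hb⟩ := h.exists_bound hw 1
  have hlim : Tendsto (fun t : ℝ => C * ‖x‖ ^ (n + 1) * t) (𝓝[>] 0) (𝓝 0) := by
    have : Tendsto (fun t : ℝ => C * ‖x‖ ^ (n + 1) * t) (𝓝 0) (𝓝 (C * ‖x‖ ^ (n + 1) * 0)) :=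
      (continuous_const.mul continuous_id).tendsto 0
    rw [mul_zero] at this
    exact this.mono_left nhdsWithin_le_nhds
  refine squeeze_zero_norm' ?_ hlim
  filter_upwards [(tendsto_smul_nhdsGT_zero x).eventually (Metric.closedBall_mem_nhds _ one_pos),
    self_mem_nhdsWithin] with t ht ht0
  have ht0' : (0 : ℝ) < t := ht0
  have h1 := hb _ ht
  have h2 : ‖t • x - ((0, 0) : ℝ × ℝ)‖ = t * ‖x‖ := by
    rw [Prod.mk_zero_zero, sub_zero, norm_smul, Real.norm_of_nonneg ht0'.le]
  rw [h2] at h1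
  rw [norm_div, Real.norm_eq_abs, Real.norm_of_nonneg (by positivity), div_le_iff₀ (by positivity)]
  calc _ ≤ C * (t * ‖x‖) ^ (n + 1) := h1
    _ = _ := by ring

theorem powRe_smul (l κ : ℂ) (n : ℕ) (t : ℝ) (x : ℝ × ℝ) :
    powRe l κ n (t • x) = t ^ n * powRe l κ n x := by
  unfold powRe
  rw [← Complex.re_ofReal_mul]
  congr 1
  simp only [Prod.smul_fst, Prod.smul_snd, smul_eq_mul, Complex.ofReal_mul, Complex.ofReal_pow]
  rw [show (t : ℂ) * x.1 + l * (t * x.2) = t * (x.1 + l * x.2) by ring, mul_pow]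
  ring

theorem lead_of_flat {u v : ℝ × ℝ → ℝ} (hv : ContDiff ℝ ∞ v) (e : v =ᶠ[𝓝 (0, 0)] u) {l κ : ℂ}
    {n : ℕ} (h : Flat (0, 0) (n + 1) fun x => v x - powRe l κ n x) : Lead l n κ u := by
  intro x
  have h1 := (h.tendsto_div_pow (hv.sub (powRe_contDiff l κ n)) x).add_const (powRe l κ n x)
  rw [zero_add] at h1
  refine h1.congr' ?_
  filter_upwards [(tendsto_smul_nhdsGT_zero x).eventually e, self_mem_nhdsWithin] with t ht ht0
  have ht0' : t ≠ 0 := ne_of_gt ht0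
  rw [powRe_smul, ht]
  field_simp
  ring

theorem exists_powRe_mul_ne_zero {l : ℂ} (hl : l.im ≠ 0) {κ₁ κ₂ : ℂ} (h1 : κ₁ ≠ 0) (h2 : κ₂ ≠ 0)
    {m n : ℕ} (hm : m ≠ 0) (hn : n ≠ 0) : ∃ x, powRe l κ₁ m x * powRe l κ₂ n x ≠ 0 := by
  obtain ⟨z, hz⟩ := exists_re_mul_pow_ne_zero h1 h2 hm hn
  refine ⟨(z.re - z.im / l.im * l.re, z.im / l.im), ?_⟩
  have : ((z.re - z.im / l.im * l.re : ℝ) : ℂ) + l * (z.im / l.im : ℝ) = z := by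
    apply Complex.ext <;> simp <;> field_simp; ring
  simp only [powRe]
  rw [this]
  exact hz

theorem Lead.mul {l κ κ' : ℂ} {n m : ℕ} {f g : ℝ × ℝ → ℝ} (hf : Lead l n κ f) (hg : Lead l m κ' g)
    (x : ℝ × ℝ) : Tendsto (fun t : ℝ => f (t • x) * g (t • x) / t ^ (n + m)) (𝓝[>] 0)
      (𝓝 (powRe l κ n x * powRe l κ' m x)) := by
  refine ((hf x).mul (hg x)).congr fun t => ?_
  rw [div_mul_div_comm, pow_add]

theorem tendsto_div_pow_of_lt {φ : ℝ → ℝ} {n m : ℕ} (hnm : n < m) {y : ℝ}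
    (h : Tendsto (fun t : ℝ => φ t / t ^ m) (𝓝[>] 0) (𝓝 y)) :
    Tendsto (fun t : ℝ => φ t / t ^ n) (𝓝[>] 0) (𝓝 0) := by
  have h1 : Tendsto (fun t : ℝ => t ^ (m - n)) (𝓝[>] 0) (𝓝 0) := by
    have : Tendsto (fun t : ℝ => t ^ (m - n)) (𝓝 0) (𝓝 (0 ^ (m - n))) :=
      (continuous_id.pow _).tendsto 0
    rw [zero_pow (by omega)] at this
    exact this.mono_left nhdsWithin_le_nhds
  have h2 := h.mul h1
  rw [mul_zero] at h2
  refine h2.congr' ?_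
  filter_upwards [self_mem_nhdsWithin] with t ht
  have ht0 : t ≠ 0 := ne_of_gt ht
  have : t ^ m = t ^ n * t ^ (m - n) := by rw [← pow_add]; congr 1; omega
  rw [this]
  field_simp

theorem Lead.order_unique {l κ κ' : ℂ} (hl : l.im ≠ 0) {n m : ℕ} {f : ℝ × ℝ → ℝ} (h : Lead l n κ f)
    (h' : Lead l m κ' f) (hκ : κ ≠ 0) (hκ' : κ' ≠ 0) (hn : n ≠ 0) (hm : m ≠ 0) : n = m := by
  obtain ⟨x, hx⟩ := exists_powRe_mul_ne_zero hl hκ hκ' hn hm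
  rcases lt_trichotomy n m with hlt | heq | hlt
  · exact absurd (tendsto_nhds_unique (h x) (tendsto_div_pow_of_lt hlt (h' x)))
      (left_ne_zero_of_mul hx)
  · exact heq
  · exact absurd (tendsto_nhds_unique (h' x) (tendsto_div_pow_of_lt hlt (h x)))
      (right_ne_zero_of_mul hx)

theorem RayFlat.false_of_lead {l κ κ' : ℂ} (hl : l.im ≠ 0) {n m : ℕ} {f g : ℝ × ℝ → ℝ}
    (h : RayFlat fun x => f x * g x) (hf : Lead l n κ f)
    (hg : Lead l m κ' g) (hκ : κ ≠ 0) (hκ' : κ' ≠ 0) (hn : n ≠ 0) (hm : m ≠ 0) : False := by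
  obtain ⟨x, hx⟩ := exists_powRe_mul_ne_zero hl hκ hκ' hn hm
  exact hx (tendsto_nhds_unique (hf.mul hg x) (h _ x))

open ComplexConjugate in
/-- No real multiple of the leading term of `g` is the leading term of `f`. -/
def LeadIndep (l : ℂ) (f g : ℝ × ℝ → ℝ) : Prop :=
  ∀ n κ κ', n ≠ 0 → κ ≠ 0 → κ' ≠ 0 → Lead l n κ f → Lead l n κ' g → (κ * conj κ').im ≠ 0

open ComplexConjugate in
theorem exists_leadIndep {l : ℂ} (hl : l.im ≠ 0) (f g : ℝ × ℝ → ℝ) :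
    ∃ k : ℝ, LeadIndep l (fun x => f x - k * g x) g := by
  by_cases h : LeadIndep l f g
  · exact ⟨0, by simpa using h⟩
  unfold LeadIndep at h
  push Not at h
  obtain ⟨n, κ, κ', hn, hκ, hκ', hf, hg, him⟩ := h
  obtain ⟨k, hk⟩ : ∃ k : ℝ, κ = k * κ' := by
    refine ⟨(κ * conj κ').re / Complex.normSq κ', ?_⟩
    have h0 : ((κ * conj κ').re : ℂ) = κ * conj κ' := by
      apply Complex.ext <;> simp [him]
    have h1 := (map_ne_zero (starRingEnd ℂ)).2 hκ'
    rw [Complex.ofReal_div, h0, Complex.normSq_eq_conj_mul_self]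
    field_simp
  refine ⟨k, fun m κ₁ κ₂ hm hκ₁ hκ₂ h1 h2 => ?_⟩
  obtain rfl := h2.order_unique hl hg hκ₂ hκ' hm hn
  exfalso
  obtain ⟨x, hx⟩ := exists_powRe_mul_ne_zero hl hκ₁ hκ₁ hm hm
  refine left_ne_zero_of_mul hx (tendsto_nhds_unique (h1 x) ?_)
  have h3 := (hf x).sub ((hg x).const_mul k)
  have h4 : powRe l κ m x - k * powRe l κ' m x = 0 := by
    rw [hk]; unfold powRe
    rw [← Complex.re_ofReal_mul, ← mul_assoc, sub_self]
  rw [h4] at h3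
  refine h3.congr fun t => ?_
  ring

open ComplexConjugate in
theorem false_of_leads {l κ₁ κ₂ κ₃ κ₄ : ℂ} (hl : l.im ≠ 0) {a b c d : ℕ}
    {f₁ f₂ f₃ f₄ : ℝ × ℝ → ℝ} (hdet : RayFlat fun x => f₁ x * f₂ x - f₃ x * f₄ x)
    (h1 : Lead l a κ₁ f₁) (h2 : Lead l b κ₂ f₂) (h3 : Lead l c κ₃ f₃) (h4 : Lead l d κ₄ f₄)
    (hκ₁ : κ₁ ≠ 0) (hκ₂ : κ₂ ≠ 0) (hκ₃ : κ₃ ≠ 0) (hκ₄ : κ₄ ≠ 0)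
    (ha : a ≠ 0) (hb : b ≠ 0) (hc : c ≠ 0) (hd : d ≠ 0)
    (h13 : LeadIndep l f₁ f₃) (h23 : LeadIndep l f₂ f₃) : False := by
  have hdeg : a + b = c + d := by
    rcases lt_trichotomy (a + b) (c + d) with hlt | heq | hlt
    · obtain ⟨x, hx⟩ := exists_powRe_mul_ne_zero hl hκ₁ hκ₂ ha hb
      refine absurd (tendsto_nhds_unique (h1.mul h2 x) ?_) hx
      have := (hdet (a + b) x).add (tendsto_div_pow_of_lt hlt (h3.mul h4 x))
      rw [add_zero] at this
      exact this.congr fun t => by ring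
    · exact heq
    · obtain ⟨x, hx⟩ := exists_powRe_mul_ne_zero hl hκ₃ hκ₄ hc hd
      refine absurd (tendsto_nhds_unique (h3.mul h4 x) ?_) hx
      have := (tendsto_div_pow_of_lt hlt (h1.mul h2 x)).sub (hdet (c + d) x)
      rw [sub_zero] at this
      exact this.congr fun t => by ring
  have hid : ∀ z : ℂ, (κ₁ * z ^ a).re * (κ₂ * z ^ b).re = (κ₃ * z ^ c).re * (κ₄ * z ^ d).re := by
    intro z
    have e : ((z.re - z.im / l.im * l.re : ℝ) : ℂ) + l * (z.im / l.im : ℝ) = z := by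
      apply Complex.ext <;> simp <;> field_simp; ring
    have k1 := h1.mul h2 (z.re - z.im / l.im * l.re, z.im / l.im)
    have k3 := h3.mul h4 (z.re - z.im / l.im * l.re, z.im / l.im)
    rw [← hdeg] at k3
    have k2 := (hdet (a + b) (z.re - z.im / l.im * l.re, z.im / l.im)).add k3
    rw [zero_add] at k2
    have := tendsto_nhds_unique k1 (k2.congr fun t => by ring)
    simpa only [powRe, e] using this
  rcases parallel_of_re_mul_pow hκ₁ hκ₂ hκ₃ hκ₄ ha hb hc hd hdeg hid with ⟨rfl, h⟩ | ⟨rfl, h⟩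
  · exact h13 _ _ _ ha hκ₁ hκ₃ h1 h3 h
  · exact h23 _ _ _ hb hκ₂ hκ₃ h2 h3 h

theorem det_eq_zero_of_rayFlat {l : ℂ} (hl : l.im ≠ 0) {Ω : Set (ℝ × ℝ)}
    {S : Set (ℝ × ℝ → ℝ)} (hsub : ∀ f ∈ S, ∀ g ∈ S, ∀ k : ℝ, (fun x => f x - k * g x) ∈ S)
    (hS : ∀ f ∈ S, (∀ x ∈ Ω, f x = 0) ∨ ∃ n κ, n ≠ 0 ∧ κ ≠ 0 ∧ Lead l n κ f)
    {f11 f12 f21 f22 : ℝ × ℝ → ℝ} (h11 : f11 ∈ S) (h12 : f12 ∈ S) (h21 : f21 ∈ S) (h22 : f22 ∈ S)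
    (h0 : (0, 0) ∈ Ω) (hΩ : IsOpen Ω)
    (hdet : RayFlat fun x => f11 x * f22 x - f12 x * f21 x) :
    ∀ x ∈ Ω, f11 x * f22 x - f12 x * f21 x = 0 := by
  have zero_left : ∀ {f₁ f₂ f₃ f₄ : ℝ × ℝ → ℝ}, f₃ ∈ S → f₄ ∈ S → (∀ x ∈ Ω, f₁ x * f₂ x = 0) →
      (RayFlat fun x => f₁ x * f₂ x - f₃ x * f₄ x) → ∀ x ∈ Ω, f₃ x * f₄ x = 0 := by
    intro f₁ f₂ f₃ f₄ h3 h4 hz h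
    have h' : RayFlat fun x => f₃ x * f₄ x := by
      intro n x
      have := (h n x).neg
      rw [neg_zero] at this
      refine this.congr' ?_
      filter_upwards [(tendsto_smul_nhdsGT_zero x).eventually (hΩ.mem_nhds h0)] with t ht
      rw [hz _ ht]; ring
    rcases hS f₃ h3 with k3 | ⟨n, κ, hn, hκ, l3⟩
    · intro x hx; rw [k3 x hx, zero_mul]
    rcases hS f₄ h4 with k4 | ⟨m, κ', hm, hκ', l4⟩
    · intro x hx; rw [k4 x hx, mul_zero]
    exact (h'.false_of_lead hl l3 l4 hκ hκ' hn hm).elim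
  have zero_right : ∀ {f₁ f₂ f₃ f₄ : ℝ × ℝ → ℝ}, f₁ ∈ S → f₂ ∈ S → (∀ x ∈ Ω, f₃ x * f₄ x = 0) →
      (RayFlat fun x => f₁ x * f₂ x - f₃ x * f₄ x) → ∀ x ∈ Ω, f₁ x * f₂ x = 0 := by
    intro f₁ f₂ f₃ f₄ h1 h2 hz h
    refine zero_left h1 h2 hz fun n x => ?_
    have := (h n x).neg
    rw [neg_zero] at this
    exact this.congr fun t => by ring
  obtain ⟨k, hk⟩ := exists_leadIndep hl f11 f12
  obtain ⟨k', hk'⟩ := exists_leadIndep hl f22 f12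
  obtain ⟨g11, hg11⟩ : ∃ g : ℝ × ℝ → ℝ, g = fun x => f11 x - k * f12 x := ⟨_, rfl⟩
  obtain ⟨g22, hg22⟩ : ∃ g : ℝ × ℝ → ℝ, g = fun x => f22 x - k' * f12 x := ⟨_, rfl⟩
  obtain ⟨g21, hg21⟩ : ∃ g : ℝ × ℝ → ℝ,
    g = fun x => (f21 x - k * f22 x) - k' * (f11 x - k * f12 x) := ⟨_, rfl⟩
  have s11 : g11 ∈ S := by rw [hg11]; exact hsub _ h11 _ h12 _
  have s22 : g22 ∈ S := by rw [hg22]; exact hsub _ h22 _ h12 _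
  have s21 : g21 ∈ S := by
    rw [hg21]; exact hsub _ (hsub _ h21 _ h22 _) _ (hsub _ h11 _ h12 _) _
  have e : ∀ x, f11 x * f22 x - f12 x * f21 x = g11 x * g22 x - f12 x * g21 x := fun x => by
    rw [hg11, hg22, hg21]; ring
  rw [← hg11] at hk
  rw [← hg22] at hk'
  simp only [e] at hdet ⊢
  have fin_right : (∀ x ∈ Ω, f12 x * g21 x = 0) → ∀ x ∈ Ω, g11 x * g22 x - f12 x * g21 x = 0 :=
    fun h x hx => by rw [h x hx, zero_right s11 s22 h hdet x hx, sub_zero]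
  have fin_left : (∀ x ∈ Ω, g11 x * g22 x = 0) → ∀ x ∈ Ω, g11 x * g22 x - f12 x * g21 x = 0 :=
    fun h x hx => by rw [h x hx, zero_left h12 s21 h hdet x hx, sub_zero]
  rcases hS _ s11 with z | ⟨a, κ₁, ha, hκ₁, l1⟩
  · exact fin_left fun x hx => by rw [z x hx, zero_mul]
  rcases hS _ s22 with z | ⟨b, κ₂, hb, hκ₂, l2⟩
  · exact fin_left fun x hx => by rw [z x hx, mul_zero]
  rcases hS _ h12 with z | ⟨c, κ₃, hc, hκ₃, l3⟩
  · exact fin_right fun x hx => by rw [z x hx, zero_mul]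
  rcases hS _ s21 with z | ⟨d, κ₄, hd, hκ₄, l4⟩
  · exact fin_right fun x hx => by rw [z x hx, mul_zero]
  exact (false_of_leads hl hdet l1 l2 l3 l4 hκ₁ hκ₂ hκ₃ hκ₄ ha hb hc hd hk hk').elim

theorem exists_root_of_pos {A B C : ℝ} (hC : 0 < C) (h : 0 < A * C - B ^ 2) :
    ∃ l : ℂ, l.im ≠ 0 ∧ (A : ℂ) + (2 * B : ℝ) * l + C * l ^ 2 = 0 := by
  have hs : √(A * C - B ^ 2) ^ 2 = A * C - B ^ 2 := Real.sq_sqrt h.le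
  have hs0 : 0 < √(A * C - B ^ 2) := Real.sqrt_pos.2 h
  set s := √(A * C - B ^ 2)
  refine ⟨⟨-B / C, s / C⟩, (div_pos hs0 hC).ne', ?_⟩
  apply Complex.ext
  · simp [pow_two]
    field_simp
    linear_combination -hs
  · simp [pow_two]
    field_simp
    ring

theorem harmonic_congr_coeff {a b : Fin 2 → Fin 2 → ℝ × ℝ → ℝ} {u v : ℝ × ℝ → ℝ} {p : ℝ × ℝ}
    (hab : ∀ i j, a i j =ᶠ[𝓝 p] b i j) (h : u =ᶠ[𝓝 p] v) :
    (fun x => ∑ i, pd i (fun y => ∑ j, a i j y * pd j u y) x) =ᶠ[𝓝 p]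
      fun x => ∑ i, pd i (fun y => ∑ j, b i j y * pd j v y) x := by
  have e : ∀ i, (fun y => ∑ j, a i j y * pd j u y) =ᶠ[𝓝 p] fun y => ∑ j, b i j y * pd j v y := by
    intro i
    filter_upwards [h.pd 0, h.pd 1, hab i 0, hab i 1] with y h0 h1 h2 h3
    simp only [Fin.sum_univ_two, h0, h1, h2, h3]
  filter_upwards [(e 0).pd 0, (e 1).pd 1] with x h0 h1
  simp only [Fin.sum_univ_two] at h0 h1 ⊢
  rw [h0, h1]

theorem harmonic_sub_const_mul {a : Fin 2 → Fin 2 → ℝ × ℝ → ℝ} (ha : ∀ i j, ContDiff ℝ ∞ (a i j))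
    {f g : ℝ × ℝ → ℝ} (hf : ContDiff ℝ ∞ f) (hg : ContDiff ℝ ∞ g) (k : ℝ) (x : ℝ × ℝ) :
    ∑ i, pd i (fun y => ∑ j, a i j y * pd j (fun z => f z - k * g z) y) x =
      ∑ i, pd i (fun y => ∑ j, a i j y * pd j f y) x -
        k * ∑ i, pd i (fun y => ∑ j, a i j y * pd j g y) x := by
  have hkg : ContDiff ℝ ∞ fun z => k * g z := contDiff_const.mul hg
  have smooth : ∀ {u : ℝ × ℝ → ℝ}, ContDiff ℝ ∞ u → ∀ i,
      ContDiff ℝ ∞ fun y => ∑ j, a i j y * pd j u y := fun hu i =>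
    ContDiff.sum fun j _ => (ha i j).mul (pd_contDiff hu j)
  have e : ∀ i, (fun y => ∑ j, a i j y * pd j (fun z => f z - k * g z) y) = fun y =>
      (∑ j, a i j y * pd j f y) - k * ∑ j, a i j y * pd j g y := by
    intro i
    ext y
    simp only [Fin.sum_univ_two, pd_sub hf hkg, pd_const_mul hg]
    ring
  rw [Finset.mul_sum, ← Finset.sum_sub_distrib]
  refine Finset.sum_congr rfl fun i _ => ?_
  rw [e, pd_sub (smooth hf i) (contDiff_const.mul (smooth hg i)), pd_const_mul (smooth hg i)]

theorem exists_contDiff_coeff {Ω : Set (ℝ × ℝ)} (hΩ : IsOpen Ω) {a : Fin 2 → Fin 2 → ℝ × ℝ → ℝ}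
    (ha : ∀ i j, ContDiffOn ℝ ∞ (a i j) Ω) {p : ℝ × ℝ} (hp : p ∈ Ω) :
    ∃ b : Fin 2 → Fin 2 → ℝ × ℝ → ℝ,
      (∀ i j, ContDiff ℝ ∞ (b i j)) ∧ ∀ i j, a i j =ᶠ[𝓝 p] b i j := by
  choose b hb e using fun i j => exists_contDiff_eventuallyEq hΩ (ha i j) hp
  exact ⟨b, hb, fun i j => (e i j).symm⟩

theorem harmonicOn_sub_const_mul {Ω : Set (ℝ × ℝ)} (hΩ : IsOpen Ω)
    {a : Fin 2 → Fin 2 → ℝ × ℝ → ℝ} (ha : ∀ i j, ContDiffOn ℝ ∞ (a i j) Ω) {f g : ℝ × ℝ → ℝ}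
    (hf : ContDiffOn ℝ ∞ f Ω) (hg : ContDiffOn ℝ ∞ g Ω)
    (hLf : ∀ x ∈ Ω, ∑ i, pd i (fun y => ∑ j, a i j y * pd j f y) x = 0)
    (hLg : ∀ x ∈ Ω, ∑ i, pd i (fun y => ∑ j, a i j y * pd j g y) x = 0) (k : ℝ) :
    ∀ x ∈ Ω, ∑ i, pd i (fun y => ∑ j, a i j y * pd j (fun z => f z - k * g z) y) x = 0 := by
  intro x hx
  obtain ⟨b, hb, hab⟩ := exists_contDiff_coeff hΩ ha hx
  obtain ⟨f', hf', ef⟩ := exists_contDiff_eventuallyEq hΩ hf hx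
  obtain ⟨g', hg', eg⟩ := exists_contDiff_eventuallyEq hΩ hg hx
  have e : (fun z => f z - k * g z) =ᶠ[𝓝 x] fun z => f' z - k * g' z := by
    filter_upwards [ef, eg] with z h1 h2
    rw [h1, h2]
  have e1 := (harmonic_congr_coeff hab e).eq_of_nhds
  have e2 := (harmonic_congr_coeff hab ef.symm).eq_of_nhds
  have e3 := (harmonic_congr_coeff hab eg.symm).eq_of_nhds
  rw [e1, harmonic_sub_const_mul hb hf' hg', ← e2, ← e3, hLf x hx, hLg x hx]
  simp

theorem harmonic_dichotomy {Ω : Set (ℝ × ℝ)} (hΩ : IsOpen Ω) (hconn : IsConnected Ω)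
    (h0 : ((0 : ℝ), (0 : ℝ)) ∈ Ω) {a : Fin 2 → Fin 2 → ℝ × ℝ → ℝ}
    (ha : ∀ i j, ContDiffOn ℝ ∞ (a i j) Ω) (hsym : ∀ i j, ∀ p ∈ Ω, a i j p = a j i p)
    (hpos : ∀ p ∈ Ω, ∀ ξ : Fin 2 → ℝ, ξ ≠ 0 → 0 < ∑ i, ∑ j, a i j p * ξ i * ξ j) :
    ∃ l : ℂ, l.im ≠ 0 ∧ ∀ u : ℝ × ℝ → ℝ, ContDiffOn ℝ ∞ u Ω →
      (∀ x ∈ Ω, ∑ i, pd i (fun y => ∑ j, a i j y * pd j u y) x = 0) → u (0, 0) = 0 →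
      (∀ x ∈ Ω, u x = 0) ∨ ∃ n κ, n ≠ 0 ∧ κ ≠ 0 ∧ Lead l n κ u := by
  classical
  have hC : 0 < a 1 1 (0, 0) := by
    have := hpos _ h0 ![0, 1] (fun h => by simpa using congrFun h 1)
    simpa [Fin.sum_univ_two] using this
  have hD : 0 < a 0 0 (0, 0) * a 1 1 (0, 0) - a 0 1 (0, 0) ^ 2 := by
    have := hpos _ h0 ![a 1 1 (0, 0), -a 0 1 (0, 0)] (fun h => hC.ne' (by simpa using congrFun h 0))
    simp only [Fin.sum_univ_two, Matrix.cons_val_zero, Matrix.cons_val_one] at this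
    rw [hsym 1 0 _ h0] at this
    have h2 : 0 < a 1 1 (0, 0) * (a 0 0 (0, 0) * a 1 1 (0, 0) - a 0 1 (0, 0) ^ 2) := by
      refine this.trans_eq ?_
      ring
    exact pos_of_mul_pos_right h2 hC.le
  obtain ⟨l, hl, hroot⟩ := exists_root_of_pos hC hD
  refine ⟨l, hl, fun u hu hL hu0 => ?_⟩
  obtain ⟨b, hb, hab⟩ := exists_contDiff_coeff hΩ ha h0
  obtain ⟨v, hv, e⟩ := exists_contDiff_eventuallyEq hΩ hu h0
  have hab0 : ∀ i j, b i j (0, 0) = a i j (0, 0) := fun i j => (hab i j).eq_of_nhds.symm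
  have hLu : ∀ᶠ x in 𝓝 ((0 : ℝ), (0 : ℝ)),
      ∑ i, pd i (fun y => ∑ j, a i j y * pd j u y) x = 0 := by
    filter_upwards [hΩ.mem_nhds h0] with x hx using hL x hx
  by_cases hfl : ∀ n, Flat (0, 0) n v
  · left
    refine eqOn_zero_of_harmonic hΩ hconn ha hsym hpos hu hL h0 (e.symm.trans ?_)
    refine eventuallyEq_zero_of_harmonic hΩ ha hsym hpos h0 hv ?_ hfl
    filter_upwards [harmonic_congr (a := a) e, hLu] with x h1 h2
    rw [h1, h2]
  · right
    push Not at hfl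
    have h1 : Flat (0, 0) 1 v := ⟨by rw [e.eq_of_nhds, hu0], fun _ => trivial⟩
    obtain ⟨m, hm, hm'⟩ : ∃ m, Flat (0, 0) (m + 1) v ∧ ¬Flat (0, 0) (m + 2) v := by
      by_contra! H
      obtain ⟨n, hn⟩ := hfl
      have : ∀ n, Flat (0, 0) (n + 1) v := fun n => by
        induction n with
        | zero => exact h1
        | succ n ih => exact H n ih
      exact hn ((this n).mono (Nat.le_succ n))
    have hLv : ∀ᶠ x in 𝓝 ((0 : ℝ), (0 : ℝ)),
        ∑ i, pd i (fun y => ∑ j, b i j y * pd j v y) x = 0 := by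
      filter_upwards [harmonic_congr_coeff hab e.symm, hLu] with x h1 h2
      rw [← h1, h2]
    have hsec := Flat.secondOrder_of_harmonic hb hv
      (by rw [hab0, hab0, hsym 1 0 _ h0]) hLv hm
    simp only [hab0] at hsec
    obtain ⟨κ, hκ, h⟩ := exists_leading_term hv hl hC.ne' hroot hm hm' hsec
    exact ⟨m + 1, κ, m.succ_ne_zero, hκ, lead_of_flat hv e h⟩

theorem rayFlat_of_iteratedFDeriv {Ω : Set (ℝ × ℝ)} (hΩ : IsOpen Ω)
    (h0 : ((0 : ℝ), (0 : ℝ)) ∈ Ω) {u : ℝ × ℝ → ℝ} (hu : ContDiffOn ℝ ∞ u Ω)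
    (h : ∀ n, iteratedFDeriv ℝ n u (0, 0) = 0) : RayFlat u := by
  obtain ⟨v, hv, e⟩ := exists_contDiff_eventuallyEq hΩ hu h0
  have hflat : ∀ n, Flat (0, 0) n v := Flat.of_iteratedFDeriv hv fun n => by
    rw [(e.iteratedFDeriv ℝ n).eq_of_nhds, h]
  intro n x
  refine ((hflat (n + 1)).tendsto_div_pow hv x).congr' ?_
  filter_upwards [(tendsto_smul_nhdsGT_zero x).eventually e] with t ht
  rw [ht]

end

/-- If four `A`-harmonic functions `f_{kl}` all vanish at `0` and
`f₁₁f₂₂ − f₁₂f₂₁` vanishes to infinite order at `0`, then `f₁₁f₂₂ = f₁₂f₂₁`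
identically. -/
theorem stmt_15 (Ω : Set (ℝ × ℝ)) (hΩopen : IsOpen Ω) (hΩconn : IsConnected Ω)
    (h0 : ((0:ℝ), (0:ℝ)) ∈ Ω)
    (a : Fin 2 → Fin 2 → ℝ × ℝ → ℝ)
    (ha : ∀ i j, ContDiffOn ℝ (⊤ : ℕ∞) (a i j) Ω)
    (hsym : ∀ i j, ∀ p ∈ Ω, a i j p = a j i p)
    (hpos : ∀ p ∈ Ω, ∀ ξ : Fin 2 → ℝ, ξ ≠ 0 →
      0 < ∑ i, ∑ j, a i j p * ξ i * ξ j)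
    (f11 f12 f21 f22 : ℝ × ℝ → ℝ)
    (hf11 : ContDiffOn ℝ (⊤ : ℕ∞) f11 Ω) (hf12 : ContDiffOn ℝ (⊤ : ℕ∞) f12 Ω)
    (hf21 : ContDiffOn ℝ (⊤ : ℕ∞) f21 Ω) (hf22 : ContDiffOn ℝ (⊤ : ℕ∞) f22 Ω)
    (hharm : ∀ f ∈ ({f11, f12, f21, f22} : Set (ℝ × ℝ → ℝ)),
      ∀ p ∈ Ω, ∑ i, pd i (fun q => ∑ j, a i j q * pd j f q) p = 0)
    (hvan : ∀ n : ℕ,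
      iteratedFDeriv ℝ n (fun q => f11 q * f22 q - f12 q * f21 q)
        ((0:ℝ), (0:ℝ)) = 0)
    (hzero : f11 ((0:ℝ), (0:ℝ)) = 0 ∧ f12 ((0:ℝ), (0:ℝ)) = 0 ∧
      f21 ((0:ℝ), (0:ℝ)) = 0 ∧ f22 ((0:ℝ), (0:ℝ)) = 0) :
    ∀ p ∈ Ω, f11 p * f22 p = f12 p * f21 p := by
  have hf : ∀ f ∈ ({f11, f12, f21, f22} : Set (ℝ × ℝ → ℝ)),
      ContDiffOn ℝ (⊤ : ℕ∞) f Ω ∧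
        (∀ x ∈ Ω, ∑ i, pd i (fun y => ∑ j, a i j y * pd j f y) x = 0) ∧ f (0, 0) = 0 := by
    intro f hf
    refine ⟨?_, hharm f hf, ?_⟩
    · rcases hf with rfl | rfl | rfl | rfl <;> assumption
    · rcases hf with rfl | rfl | rfl | rfl
      exacts [hzero.1, hzero.2.1, hzero.2.2.1, hzero.2.2.2]
  obtain ⟨l, hl, hdich⟩ := harmonic_dichotomy hΩopen hΩconn h0 ha hsym hpos
  have hdet := rayFlat_of_iteratedFDeriv hΩopen h0 ((hf11.mul hf22).sub (hf12.mul hf21)) hvan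
  intro p hp
  refine sub_eq_zero.1 (det_eq_zero_of_rayFlat hl
    (S := {u | ContDiffOn ℝ (⊤ : ℕ∞) u Ω ∧
      (∀ x ∈ Ω, ∑ i, pd i (fun y => ∑ j, a i j y * pd j u y) x = 0) ∧ u (0, 0) = 0})
    (fun f hf g hg k => ⟨hf.1.sub (contDiffOn_const.mul hg.1),
      harmonicOn_sub_const_mul hΩopen ha hf.1 hg.1 hf.2.1 hg.2.1 k, ?_⟩)
    (fun f hf => hdich f hf.1 hf.2.1 hf.2.2)
    (hf _ (by simp)) (hf _ (by simp)) (hf _ (by simp)) (hf _ (by simp)) h0 hΩopen hdet p hp)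
  change f (0, 0) - k * g (0, 0) = 0
  rw [hf.2.2, hg.2.2, mul_zero, sub_zero]
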